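/- Let d ≥ 1, β > 0, and let h ∈ (ℝ^d)^ℕ be a deterministic field satisfying: m_n → 0 ∈ ℝ^d, s_n → s ∈ (0,∞)^d, Σ_{(i,j)∈ℕ×{1,…,d}} |h_j(i)|/2^{i+j} < ∞, ‖s‖ < 1, β > d/(1 − ‖s‖²), and n‖m_n‖ → ∞. Set r* = sqrt(1 − d/β − ‖s‖²), y* = s, and m̂_n = m_n/‖m_n‖ (defined for n with m_n ≠ 0). Then d_BL1( μ_n^{β,h}, ν^{r* m̂_n, y*, h} ) → 0 as n → ∞. -/

import Mathlib

open MeasureTheory Filter Topology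

noncomputable def ip {d : ℕ} (x y : Fin d → ℝ) : ℝ := ∑ j, x j * y j

noncomputable def sampleMean (d : ℕ) (h : ℕ → Fin d → ℝ) (n : ℕ) : Fin d → ℝ :=
  fun j => (∑ i ∈ Finset.range n, h i j) / n

noncomputable def sampleStd (d : ℕ) (h : ℕ → Fin d → ℝ) (n : ℕ) : Fin d → ℝ :=
  fun j => Real.sqrt ((∑ i ∈ Finset.range n, (h i j) ^ 2) / n - (sampleMean d h n j) ^ 2)

/-- Membership in the open unit ball `B_{2d}(0,1) ⊂ ℝ^d × ℝ^d`. -/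
def inBall (d : ℕ) (x y : Fin d → ℝ) : Prop := ip x x + ip y y < 1

def ballSet (d : ℕ) : Set ((Fin d → ℝ) × (Fin d → ℝ)) := {p | inBall d p.1 p.2}

/-- The exponential tilting function with mean vector `m` and standard deviation vector `s`. -/
noncomputable def psi (d : ℕ) (β : ℝ) (m s : Fin d → ℝ) (x y : Fin d → ℝ) : ℝ :=
  β / 2 * ip x x + β * ip m x + β * ip s y + (d : ℝ) / 2 * Real.log (1 - ip x x - ip y y)
/-- The weight 2^{-(i+j)} for site i ∈ ℕ (counted from 1) and component j ∈ {1,…,d}. -/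
noncomputable def w (d : ℕ) (p : ℕ × Fin d) : ℝ :=
  ((1 : ℝ) / 2) ^ (p.1 + 1 + ((p.2 : ℕ) + 1))

/-- The normalizing constant C(d) = Σ_{(i,j)} 2^{-(i+j)}. -/
noncomputable def Cd (d : ℕ) : ℝ := ∑' p : ℕ × Fin d, w d p

/-- The metric on the configuration space (ℝ^d)^ℕ. -/
noncomputable def cfgDist (d : ℕ) (φ φ' : ℕ → Fin d → ℝ) : ℝ :=
  (Cd d)⁻¹ * ∑' p : ℕ × Fin d, w d p * min |φ p.1 p.2 - φ' p.1 p.2| 1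

/-- The bounded Lipschitz distance between probability measures on (ℝ^d)^ℕ. -/
noncomputable def blDistCfg (d : ℕ) (μ ν : Measure (ℕ → Fin d → ℝ)) : ℝ :=
  sSup {r : ℝ | ∃ f : (ℕ → Fin d → ℝ) → ℝ, (∀ φ, |f φ| ≤ 1) ∧
    (∀ φ φ', |f φ - f φ'| ≤ cfgDist d φ φ') ∧ r = |∫ φ, f φ ∂μ - ∫ φ, f φ ∂ν|}

/-- The Hamiltonian Hₙ^h(φ) = −(1/(2n)) Σ_{i,i'} ⟨φ(i),φ(i')⟩ − Σ_i ⟨h(i),φ(i)⟩. -/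
noncomputable def Hn (d n : ℕ) (h : ℕ → Fin d → ℝ) (φ : Fin n → Fin d → ℝ) : ℝ :=
  -(1 / (2 * (n : ℝ))) * ∑ i : Fin n, ∑ i' : Fin n, ip (φ i) (φ i') -
    ∑ i : Fin n, ip (h (i : ℕ)) (φ i)

/-- The finite-volume Gibbs state μₙ^{β,h}: the normalized measure on the sphere
√n·S^{nd−1} with Boltzmann weight e^{−βHₙ}, relative to the surface
((nd−1)-dimensional Hausdorff) measure, pushed to (ℝ^d)^ℕ by extending with 0. -/
noncomputable def gibbs (d n : ℕ) (β : ℝ) (h : ℕ → Fin d → ℝ) :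
    Measure (ℕ → Fin d → ℝ) :=
  let ρ : Measure (Metric.sphere (0 : EuclideanSpace ℝ (Fin n × Fin d)) 1) :=
    (μH[((n * d : ℕ) : ℝ) - 1]).withDensity fun Ωp =>
      ENNReal.ofReal (Real.exp (-β * Hn d n h fun i j =>
        Real.sqrt n * Ωp.val (i, j)))
  ((ρ Set.univ)⁻¹ • ρ).map fun Ωp (i : ℕ) (j : Fin d) =>
    if hi : i < n then Real.sqrt n * Ωp.val (⟨i, hi⟩, j) else 0

/-- `ν` is the product probability measure on (ℝ^d)^ℕ whose (i,j)-coordinate marginal is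
Gaussian with mean `mean i j` and variance `v`, characterized through its
finite-dimensional marginals. -/
def IsProdGaussian (d : ℕ) (mean : ℕ → Fin d → ℝ) (v : NNReal)
    (ν : Measure (ℕ → Fin d → ℝ)) : Prop :=
  IsProbabilityMeasure ν ∧
    ∀ n : ℕ, ν.map (fun φ (i : Fin n) => φ (i : ℕ)) =
      Measure.pi fun i : Fin n =>
        Measure.pi fun j : Fin d => ProbabilityTheory.gaussianReal (mean (i : ℕ) j) v

/-- The mean of the (i,j)-marginal of the product state ν^{x,y,h}. -/
noncomputable def pureMean (d : ℕ) (h : ℕ → Fin d → ℝ) (m s x y : Fin d → ℝ) :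
    ℕ → Fin d → ℝ :=
  fun i j => x j + y j * (h i j - m j) / s j

/-- The variance (1 − ‖x‖² − ‖y‖²)/d of the marginals of the product state ν^{x,y,h}. -/
noncomputable def pureVar (d : ℕ) (x y : Fin d → ℝ) : NNReal :=
  ((1 - ip x x - ip y y) / d).toNNReal

/-- A measure on an inner product space is rotation invariant if every linear isometric
automorphism preserves it. -/
def RotInv {V : Type*} [NormedAddCommGroup V] [InnerProductSpace ℝ V] [MeasurableSpace V]
    (μ : Measure V) : Prop :=
  ∀ L : V ≃ₗᵢ[ℝ] V, μ.map L = μ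

section RotationInvariance

variable {V : Type*} [NormedAddCommGroup V] [InnerProductSpace ℝ V]

lemma exists_linearIsometryEquiv_apply_eq {x y : V} (h : ‖x‖ = ‖y‖) :
    ∃ L : V ≃ₗᵢ[ℝ] V, L x = y :=
  ⟨_, Submodule.reflection_sub h⟩

variable [MeasurableSpace V] [BorelSpace V]

lemma RotInv.charFun_eq {μ : Measure V} (hμ : RotInv μ) {x y : V} (h : ‖x‖ = ‖y‖) :
    charFun μ x = charFun μ y := by
  obtain ⟨L, rfl⟩ := exists_linearIsometryEquiv_apply_eq h
  conv_rhs => rw [← hμ L, charFun_apply]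
  rw [MeasurableEmbedding.integral_map (f := L) L.toHomeomorph.isClosedEmbedding.measurableEmbedding]
  simp [charFun_apply]

/-- Two rotation invariant finite measures concentrated on the unit sphere are proportional. -/
lemma RotInv.smul_eq_smul [CompleteSpace V] [SecondCountableTopology V] {μ σ : Measure V}
    [IsFiniteMeasure μ] [IsFiniteMeasure σ] (hμ : RotInv μ) (hσ : RotInv σ)
    (hμ1 : ∀ᵐ x ∂μ, ‖x‖ = 1) (hσ1 : ∀ᵐ x ∂σ, ‖x‖ = 1) :
    (σ Set.univ) • μ = (μ Set.univ) • σ := by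
  have key : ∀ (μ σ : Measure V) [IsFiniteMeasure μ] [IsFiniteMeasure σ], RotInv μ →
      (∀ᵐ x ∂σ, ‖x‖ = 1) → ∀ t : V, ∫ y, ∫ x, Complex.exp (‖t‖ * inner ℝ x y * Complex.I) ∂μ ∂σ
        = σ.real Set.univ * charFun μ t := by
    intro μ σ _ _ hμ hσ1 t
    rw [integral_congr_ae (g := fun _ => charFun μ t)]
    · simp [integral_const]
    · filter_upwards [hσ1] with y hy
      rw [hμ.charFun_eq (y := ‖t‖ • y) (by simp [norm_smul, hy])]
      simp [charFun_apply, inner_smul_right]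
  have hf : ∀ (m : Measure V) [IsFiniteMeasure m] (c : ENNReal), c ≠ ⊤ → IsFiniteMeasure (c • m) :=
    fun m _ c hc => ⟨by simp [ENNReal.mul_lt_top hc.lt_top (measure_lt_top m _)]⟩
  have := hf μ (σ Set.univ) (measure_ne_top _ _)
  have := hf σ (μ Set.univ) (measure_ne_top _ _)
  refine Measure.ext_of_charFun ?_
  ext t
  have h1 := key μ σ hμ hσ1 t
  have h2 := key σ μ hσ hμ1 t
  rw [integral_integral_swap] at h1
  · have : ∀ (m : Measure V) (c : ENNReal), charFun (c • m) t = c.toReal * charFun m t := by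
      intro m c
      simp [charFun_apply, integral_smul_measure]
    rw [this, this]
    simp only [Measure.real] at h1 h2
    rw [← h1, ← h2]
    congr! 6 with x y
    rw [real_inner_comm]
  · refine (integrable_const (1 : ℝ)).mono' ?_ ?_
    · apply Continuous.aestronglyMeasurable
      simp only [Function.uncurry_def]
      fun_prop
    · refine Eventually.of_forall fun p => ?_
      have : (‖t‖ * inner ℝ p.2 p.1 * Complex.I : ℂ)
        = ((‖t‖ * inner ℝ p.2 p.1 : ℝ) : ℂ) * Complex.I := by push_cast; ring
      simp only [Function.uncurry_def, this, Complex.norm_exp_ofReal_mul_I, le_refl]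

end RotationInvariance

section HausdorffSphere

variable {ι : Type*} [Fintype ι]

lemma card_subtype_ne_cast [DecidableEq ι] (k : ι) :
    (Fintype.card {j // j ≠ k} : ℝ) = (Fintype.card ι : ℝ) - 1 := by
  have h := Fintype.card_subtype_compl (fun j => j = k)
  have hpos : 1 ≤ Fintype.card ι := Fintype.card_pos_iff.2 ⟨k⟩
  rw [Fintype.card_subtype_eq] at h
  rw [h, Nat.cast_sub hpos, Nat.cast_one]

lemma hausdorffMeasure_sphere_pos [Nonempty ι] :
    0 < μH[(Fintype.card ι : ℝ) - 1] (Metric.sphere (0 : EuclideanSpace ℝ ι) 1) := by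
  classical
  obtain ⟨k⟩ := ‹Nonempty ι›
  set N : ℝ := (Fintype.card ι : ℝ) with hN
  have hN1 : 1 ≤ N := by
    have : 1 ≤ Fintype.card ι := Fintype.card_pos_iff.2 ⟨k⟩
    rw [hN]; exact_mod_cast this
  let f : EuclideanSpace ℝ ι → ({j // j ≠ k} → ℝ) := fun x j => x j
  have hf : LipschitzWith 1 f := by
    refine LipschitzWith.mk_one fun x y => (dist_pi_le_iff dist_nonneg).2 fun j => ?_
    rw [dist_eq_norm, dist_eq_norm]
    exact PiLp.norm_apply_le (x - y) (j : ι)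
  have hsub : Metric.ball (0 : {j // j ≠ k} → ℝ) (1 / N) ⊆
      f '' Metric.sphere (0 : EuclideanSpace ℝ ι) 1 := by
    intro y hy
    have hyj : ∀ j, |y j| ≤ 1 / N := fun j => by
      have := (norm_le_pi_norm y j).trans (mem_ball_zero_iff.1 hy).le
      simpa using this
    have hsum : ∑ j, (y j) ^ 2 ≤ 1 := by
      calc ∑ j, (y j) ^ 2 ≤ ∑ j : {j // j ≠ k}, (1 / N) := by
            refine Finset.sum_le_sum fun j _ => ?_
            rw [← sq_abs]
            have h1 : 1 / N ≤ 1 := by rw [div_le_one (by linarith)]; exact hN1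
            nlinarith [hyj j, abs_nonneg (y j)]
        _ = (N - 1) * (1 / N) := by
            rw [Finset.sum_const, Finset.card_univ, nsmul_eq_mul, card_subtype_ne_cast k]
        _ ≤ 1 := by
            rw [mul_one_div, div_le_one (by linarith)]; linarith
    refine ⟨WithLp.toLp 2 fun j => if hj : j ≠ k then y ⟨j, hj⟩ else
      Real.sqrt (1 - ∑ j, (y j) ^ 2), ?_, ?_⟩
    · rw [mem_sphere_zero_iff_norm, EuclideanSpace.norm_eq, Real.sqrt_eq_one,
        Fintype.sum_eq_add_sum_subtype_ne _ k]
      have : ∀ j : {j // j ≠ k}, (if hj : (j : ι) ≠ k then y ⟨j, hj⟩ else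
        Real.sqrt (1 - ∑ j, (y j) ^ 2)) = y j := fun j => by simp [j.2]
      simp only [this]
      simp [Real.sq_sqrt (sub_nonneg.2 hsum)]
    · ext j
      simp [f, j.2]
  have h1 : 0 < μH[N - 1] (Metric.ball (0 : {j // j ≠ k} → ℝ) (1 / N)) := by
    rw [hN, ← card_subtype_ne_cast k, hausdorffMeasure_pi_real]
    exact Metric.measure_ball_pos _ _ (by positivity)
  have h2 := hf.hausdorffMeasure_image_le (d := N - 1) (by linarith)
    (Metric.sphere (0 : EuclideanSpace ℝ ι) 1)
  simp only [ENNReal.coe_one, ENNReal.one_rpow, one_mul] at h2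
  exact h1.trans_le ((measure_mono hsub).trans h2)

lemma hausdorffMeasure_sphere_patch_lt_top [DecidableEq ι] (k : ι) (ε : ℝ) {c : ℝ} (hc : 0 < c) :
    μH[(Fintype.card ι : ℝ) - 1]
      {x : EuclideanSpace ℝ ι | x ∈ Metric.sphere 0 1 ∧ c ≤ ε * x k} < ⊤ := by
  set S := {x : EuclideanSpace ℝ ι | x ∈ Metric.sphere 0 1 ∧ c ≤ ε * x k} with hS
  set N : ℝ := (Fintype.card ι : ℝ) with hN
  have hN1 : 1 ≤ N := by
    have : 1 ≤ Fintype.card ι := Fintype.card_pos_iff.2 ⟨k⟩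
    rw [hN]; exact_mod_cast this
  have hle : ∀ x ∈ S, ∀ j, |x j| ≤ 1 := fun x hx j => by
    have := PiLp.norm_apply_le x j
    rwa [mem_sphere_zero_iff_norm.1 hx.1, Real.norm_eq_abs] at this
  have hsq : ∀ x ∈ S, ∑ j, (x j) ^ 2 = 1 := fun x hx => by
    have := mem_sphere_zero_iff_norm.1 hx.1
    rw [EuclideanSpace.norm_eq, Real.sqrt_eq_one] at this
    simpa using this
  let f : S → ({j // j ≠ k} → ℝ) := fun x j => x.1 j
  set C : ℝ := N * (1 + N * (|ε| / c)) with hC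
  have hC0 : 0 ≤ C := by positivity
  have hf : AntilipschitzWith ⟨C, hC0⟩ f := by
    refine AntilipschitzWith.of_le_mul_dist fun x y => ?_
    set D := dist (f x) (f y)
    have hj : ∀ j : {j // j ≠ k}, |x.1 j - y.1 j| ≤ D := fun j => dist_le_pi_dist (f x) (f y) j
    have hD : 0 ≤ D := dist_nonneg
    have hk : |x.1 k - y.1 k| ≤ N * (|ε| / c) * D := by
      have h0 : (x.1 k - y.1 k) * (x.1 k + y.1 k)
          = - ∑ j : {j // j ≠ k}, (x.1 j - y.1 j) * (x.1 j + y.1 j) := by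
        have h1 := hsq x x.2
        have h2 := hsq y y.2
        rw [Fintype.sum_eq_add_sum_subtype_ne _ k] at h1 h2
        have : ∑ j : {j // j ≠ k}, (x.1 j - y.1 j) * (x.1 j + y.1 j) =
            ∑ j : {j // j ≠ k}, (x.1 j) ^ 2 - ∑ j : {j // j ≠ k}, (y.1 j) ^ 2 := by
          rw [← Finset.sum_sub_distrib]
          exact Finset.sum_congr rfl fun j _ => by ring
        rw [this]; linarith
      have h3 : |∑ j : {j // j ≠ k}, (x.1 j - y.1 j) * (x.1 j + y.1 j)| ≤ N * (D * 2) := by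
        calc _ ≤ ∑ j : {j // j ≠ k}, |(x.1 j - y.1 j) * (x.1 j + y.1 j)| :=
              Finset.abs_sum_le_sum_abs _ _
          _ ≤ ∑ j : {j // j ≠ k}, D * 2 := by
              refine Finset.sum_le_sum fun j _ => ?_
              rw [abs_mul]
              refine mul_le_mul (hj j) ?_ (abs_nonneg _) hD
              exact (abs_add_le _ _).trans (by linarith [hle x x.2 j, hle y y.2 j])
          _ = (N - 1) * (D * 2) := by
            rw [Finset.sum_const, Finset.card_univ, nsmul_eq_mul, card_subtype_ne_cast k]
          _ ≤ N * (D * 2) := by gcongr; linarith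
      have h4 : 2 * c ≤ |ε| * |x.1 k + y.1 k| := by
        rw [← abs_mul]
        refine le_trans ?_ (le_abs_self _)
        have := x.2.2
        have := y.2.2
        linarith
      have h5 : |x.1 k - y.1 k| * |x.1 k + y.1 k| ≤ N * (D * 2) := by
        rw [← abs_mul, h0, abs_neg]; exact h3
      have h6 : |x.1 k - y.1 k| * (2 * c) ≤ |ε| * (N * (D * 2)) := by
        calc |x.1 k - y.1 k| * (2 * c) ≤ |x.1 k - y.1 k| * (|ε| * |x.1 k + y.1 k|) := by gcongr
          _ = |ε| * (|x.1 k - y.1 k| * |x.1 k + y.1 k|) := by ring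
          _ ≤ _ := by gcongr
      have h7 : |x.1 k - y.1 k| ≤ |ε| * (N * (D * 2)) / (2 * c) :=
        (le_div_iff₀ (by positivity)).2 h6
      refine h7.trans (le_of_eq ?_)
      field_simp
    have hall : ∀ j, |x.1 j - y.1 j| ≤ (1 + N * (|ε| / c)) * D := fun j => by
      by_cases h : j = k
      · subst h; linarith
      · have h1 := hj ⟨j, h⟩
        have h2 : 0 ≤ N * (|ε| / c) * D := by positivity
        simp only at h1
        linarith
    have h8 : dist x y ≤ ∑ j, |x.1 j - y.1 j| := by
      rw [Subtype.dist_eq, EuclideanSpace.dist_eq]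
      simp only [Real.dist_eq, sq_abs]
      rw [Real.sqrt_le_left (Finset.sum_nonneg fun _ _ => abs_nonneg _)]
      calc ∑ j, (x.1 j - y.1 j) ^ 2 = ∑ j, |x.1 j - y.1 j| ^ 2 := by simp
        _ ≤ _ := Finset.sum_sq_le_sq_sum_of_nonneg fun _ _ => abs_nonneg _
    calc dist x y ≤ _ := h8
      _ ≤ ∑ _j : ι, (1 + N * (|ε| / c)) * D := Finset.sum_le_sum fun j _ => hall j
      _ = C * D := by simp [hC, hN]; ring
  have h1 : μH[N - 1] S = μH[N - 1] (Set.univ : Set S) := by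
    have := isometry_subtype_coe (s := S) |>.hausdorffMeasure_image (d := N - 1)
      (Or.inl (by linarith)) Set.univ
    simpa using this
  rw [h1]
  refine (hf.le_hausdorffMeasure_image (d := N - 1) (by linarith) Set.univ).trans_lt ?_
  refine ENNReal.mul_lt_top (ENNReal.rpow_lt_top_of_nonneg (by linarith) ENNReal.coe_ne_top) ?_
  rw [hN, ← card_subtype_ne_cast k, hausdorffMeasure_pi_real]
  refine (measure_mono (t := Metric.closedBall 0 1) ?_).trans_lt measure_closedBall_lt_top
  rintro _ ⟨x, -, rfl⟩
  rw [mem_closedBall_zero_iff, pi_norm_le_iff_of_nonneg zero_le_one]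
  exact fun j => hle x x.2 j

lemma hausdorffMeasure_sphere_lt_top [Nonempty ι] :
    μH[(Fintype.card ι : ℝ) - 1] (Metric.sphere (0 : EuclideanSpace ℝ ι) 1) < ⊤ := by
  classical
  set c : ℝ := 1 / Fintype.card ι with hc
  have hc0 : 0 < c := by positivity
  have hsub : Metric.sphere (0 : EuclideanSpace ℝ ι) 1 ⊆
      ⋃ k : ι, ({x : EuclideanSpace ℝ ι | x ∈ Metric.sphere 0 1 ∧ c ≤ 1 * x k} ∪
        {x : EuclideanSpace ℝ ι | x ∈ Metric.sphere 0 1 ∧ c ≤ (-1) * x k}) := by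
    intro x hx
    by_contra hcon
    simp only [Set.mem_iUnion, not_exists, Set.mem_union, Set.mem_ofPred_eq, hx, true_and, not_or,
      not_le, one_mul, neg_mul, one_mul] at hcon
    have hn := mem_sphere_zero_iff_norm.1 hx
    rw [EuclideanSpace.norm_eq, Real.sqrt_eq_one] at hn
    have hc1 : c ≤ 1 := by
      have : (1 : ℝ) ≤ Fintype.card ι := by exact_mod_cast Fintype.card_pos
      rw [hc]; exact (div_le_one (by positivity)).2 this
    have : ∑ i, ‖x i‖ ^ 2 < ∑ _i : ι, c := by
      refine Finset.sum_lt_sum_of_nonempty Finset.univ_nonempty fun i _ => ?_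
      have : |x i| < c := abs_lt.2 ⟨by linarith [(hcon i).2], (hcon i).1⟩
      rw [Real.norm_eq_abs]
      nlinarith [abs_nonneg (x i)]
    rw [hn] at this
    simp [hc] at this
  refine (measure_mono hsub).trans_lt ((measure_iUnion_le _).trans_lt ?_)
  rw [tsum_fintype]
  refine ENNReal.sum_lt_top.2 fun k _ => (measure_union_le _ _).trans_lt ?_
  exact ENNReal.add_lt_top.2 ⟨hausdorffMeasure_sphere_patch_lt_top k _ hc0,
    hausdorffMeasure_sphere_patch_lt_top k _ hc0⟩

end HausdorffSphere

section PolarSlicing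

variable {A V W : Type*} [NormedAddCommGroup A] [InnerProductSpace ℝ A] [FiniteDimensional ℝ A]
  [NormedAddCommGroup V] [InnerProductSpace ℝ V] [FiniteDimensional ℝ V]
  [NormedAddCommGroup W] [InnerProductSpace ℝ W] [FiniteDimensional ℝ W]

/-- A linear isometry extends to an isometric splitting of its codomain. -/
lemma exists_isometric_splitting (J : A →ₗᵢ[ℝ] V) :
    ∃ I : WithLp 2 (A × EuclideanSpace ℝ (Fin (Module.finrank ℝ V - Module.finrank ℝ A)))
      ≃ₗᵢ[ℝ] V, ∀ a, I (WithLp.toLp 2 (a, 0)) = J a := by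
  set X := WithLp 2 (A × EuclideanSpace ℝ (Fin (Module.finrank ℝ V - Module.finrank ℝ A)))
  have hle : Module.finrank ℝ A ≤ Module.finrank ℝ V :=
    LinearMap.finrank_le_finrank_of_injective J.injective
  have hX : Module.finrank ℝ X = Module.finrank ℝ V := by
    rw [(WithLp.linearEquiv 2 ℝ (A × _)).finrank_eq, Module.finrank_prod, finrank_euclideanSpace,
      Fintype.card_fin]
    omega
  let I₀ : X ≃ₗᵢ[ℝ] V := (stdOrthonormalBasis ℝ X).equiv (stdOrthonormalBasis ℝ V) (finCongr hX)
  let inl : A →ₗᵢ[ℝ] X :=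
    { toLinearMap := (WithLp.linearEquiv 2 ℝ (A × _)).symm.toLinearMap ∘ₗ LinearMap.inl ℝ A _
      norm_map' := fun a => by
        rw [← sq_eq_sq₀ (norm_nonneg _) (norm_nonneg _), WithLp.prod_norm_sq_eq_of_L2]
        simp }
  let T : A →ₗᵢ[ℝ] V := I₀.toLinearIsometry.comp inl
  let L : T.range →ₗᵢ[ℝ] V := J.comp T.equivRange.symm.toLinearIsometry
  refine ⟨I₀.trans (L.extend.toLinearIsometryEquiv rfl), fun a => ?_⟩
  have h1 : I₀ (WithLp.toLp 2 (a, 0)) = ((T.equivRange a : T.range) : V) := rfl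
  simp only [LinearIsometryEquiv.trans_apply, LinearIsometry.coe_toLinearIsometryEquiv, h1]
  rw [LinearIsometry.extend_apply]
  simp [L]

variable [MeasurableSpace A] [BorelSpace A] [MeasurableSpace V] [BorelSpace V]
  [MeasurableSpace W] [BorelSpace W]

lemma lintegral_eq_ofReal_mul_lintegral_smul {f : A → ENNReal} (hf : Measurable f) {r : ℝ}
    (hr : 0 < r) :
    ∫⁻ x, f x = ENNReal.ofReal (r ^ Module.finrank ℝ A) * ∫⁻ x, f (r • x) := by
  have h := Measure.map_addHaar_smul (volume : Measure A) hr.ne'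
  rw [← lintegral_map (g := fun x => r • x) hf (by fun_prop), h, lintegral_smul_measure, smul_eq_mul, ← mul_assoc,
    ← ENNReal.ofReal_mul (by positivity), abs_of_pos (by positivity),
    mul_inv_cancel₀ (by positivity)]
  simp

/-- The contraction factor `(1 + ‖a‖²)^(-1/2)`. -/
noncomputable def contr (a : A) : ℝ := (Real.sqrt (1 + ‖a‖ ^ 2))⁻¹

omit [InnerProductSpace ℝ A] [FiniteDimensional ℝ A] [MeasurableSpace A] [BorelSpace A] in
lemma contr_pos (a : A) : 0 < contr a := by unfold contr; positivity

omit [InnerProductSpace ℝ A] [FiniteDimensional ℝ A] [MeasurableSpace A] [BorelSpace A] in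
@[fun_prop]
lemma continuous_contr : Continuous (contr : A → ℝ) := by
  unfold contr
  refine Continuous.inv₀ (by fun_prop) fun a => by positivity

omit [InnerProductSpace ℝ A] [FiniteDimensional ℝ A] [BorelSpace A] in
@[fun_prop]
lemma measurable_contr [OpensMeasurableSpace A] : Measurable (contr : A → ℝ) :=
  continuous_contr.measurable

omit [FiniteDimensional ℝ A] [FiniteDimensional ℝ W] [MeasurableSpace A] [BorelSpace A]
  [MeasurableSpace W] [BorelSpace W] [InnerProductSpace ℝ W] in
lemma norm_toLp_norm_smul (a : A) (w : W) :
    ‖WithLp.toLp 2 (‖w‖ • a, w)‖ = ‖w‖ * (contr a)⁻¹ := by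
  have h : 0 ≤ 1 + ‖a‖ ^ 2 := by positivity
  rw [← sq_eq_sq₀ (norm_nonneg _) (mul_nonneg (norm_nonneg _) (inv_nonneg.2 (contr_pos a).le)),
    WithLp.prod_norm_sq_eq_of_L2, contr, inv_inv, mul_pow, Real.sq_sqrt h]
  simp [norm_smul, mul_pow]
  ring

/-- Change of variables `(a, w) ↦ (‖w‖ a, w)` followed by `w ↦ w / √(1 + ‖a‖²)`: the directions of
`V ≃ A × W` are parametrized by `A` and the directions of `W`. -/
lemma lintegral_direction_eq [Nontrivial W] (I : WithLp 2 (A × W) ≃ₗᵢ[ℝ] V) {F : V → ENNReal}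
    (hF : Measurable F) {g : ℝ → ENNReal} (hg : Measurable g) :
    ∫⁻ x : V, F (‖x‖⁻¹ • x) * (ENNReal.ofReal (‖x‖⁻¹ ^ Module.finrank ℝ A) * g ‖x‖) =
      ∫⁻ a : A, ∫⁻ w : W, F (contr a • I (WithLp.toLp 2 (a, ‖w‖⁻¹ • w))) *
        (ENNReal.ofReal (contr a ^ Module.finrank ℝ V) * g ‖w‖) := by
  set k := Module.finrank ℝ A with hk
  have hdim : Module.finrank ℝ V = k + Module.finrank ℝ W := by
    rw [← I.toLinearEquiv.finrank_eq, (WithLp.linearEquiv 2 ℝ (A × W)).finrank_eq,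
      Module.finrank_prod]
  have hmeas : Measurable fun x : V =>
      F (‖x‖⁻¹ • x) * (ENNReal.ofReal (‖x‖⁻¹ ^ k) * g ‖x‖) := by fun_prop
  have hI : Measurable (I : WithLp 2 (A × W) → V) := I.continuous.measurable
  have hL : Measurable fun p : A × W => (WithLp.toLp 2 p : WithLp 2 (A × W)) := by fun_prop
  rw [← I.measurePreserving.lintegral_comp hmeas]
  simp only [LinearIsometryEquiv.norm_map]
  have hmeas' := hmeas.comp hI
  simp only [Function.comp_def, LinearIsometryEquiv.norm_map] at hmeas'
  rw [← (WithLp.volume_preserving_toLp A W).lintegral_comp hmeas', Measure.volume_eq_prod, lintegral_prod_symm]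
  swap
  · exact (hmeas'.comp hL).aemeasurable
  have step : ∀ w : W, w ≠ 0 →
      ∫⁻ a : A, F (‖(WithLp.toLp 2 (a, w) : WithLp 2 (A × W))‖⁻¹ • I (WithLp.toLp 2 (a, w))) *
        (ENNReal.ofReal (‖(WithLp.toLp 2 (a, w) : WithLp 2 (A × W))‖⁻¹ ^ k) *
          g ‖(WithLp.toLp 2 (a, w) : WithLp 2 (A × W))‖) =
      ∫⁻ a : A, F (contr a • I (WithLp.toLp 2 (a, ‖w‖⁻¹ • w))) *
        (ENNReal.ofReal (contr a ^ k) * g (‖w‖ * (contr a)⁻¹)) := by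
    intro w hw
    have hw' : 0 < ‖w‖ := norm_pos_iff.2 hw
    rw [lintegral_eq_ofReal_mul_lintegral_smul _ hw', ← lintegral_const_mul']
    · refine lintegral_congr fun a => ?_
      rw [norm_toLp_norm_smul]
      have h1 : (‖w‖ * (contr a)⁻¹)⁻¹ • I (WithLp.toLp 2 (‖w‖ • a, w)) =
          contr a • I (WithLp.toLp 2 (a, ‖w‖⁻¹ • w)) := by
        rw [mul_inv, inv_inv, mul_comm, mul_smul, ← map_smul]
        congr 2
        rw [← WithLp.toLp_smul]
        simp [smul_smul, hw'.ne']
      have h2 : ENNReal.ofReal (contr a ^ k) = ENNReal.ofReal (‖w‖ ^ k) *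
          ENNReal.ofReal ((‖w‖ * (contr a)⁻¹)⁻¹ ^ k) := by
        rw [← ENNReal.ofReal_mul (by positivity), ← mul_pow]
        congr 2
        field_simp
      rw [h1, h2]
      ring
    · exact ENNReal.ofReal_ne_top
    · have : Measurable fun a : A => (WithLp.toLp 2 (a, w) : WithLp 2 (A × W)) := by fun_prop
      exact hmeas'.comp this
  rw [lintegral_congr_ae (g := fun w => ∫⁻ a : A,
    F (contr a • I (WithLp.toLp 2 (a, ‖w‖⁻¹ • w))) *
        (ENNReal.ofReal (contr a ^ k) * g (‖w‖ * (contr a)⁻¹)))]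
  swap
  · have : ∀ᵐ w : W, w ≠ 0 := by
      simp [ae_iff]
    filter_upwards [this] with w hw using step w hw
  have hjoint : Measurable fun p : A × W => F (contr p.1 • I (WithLp.toLp 2 (p.1, ‖p.2‖⁻¹ • p.2))) := by
    have : Measurable fun p : A × W => (p.1, ‖p.2‖⁻¹ • p.2) := by fun_prop
    have := hI.comp (hL.comp this)
    simp only [Function.comp_def] at this
    fun_prop
  rw [lintegral_lintegral_swap]
  swap
  · have h2 : Measurable fun p : A × W => ENNReal.ofReal (contr p.1 ^ k) *
        g (‖p.2‖ * (contr p.1)⁻¹) := by fun_prop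
    exact ((hjoint.mul h2).comp measurable_swap).aemeasurable
  refine lintegral_congr fun a => ?_
  have hFa : Measurable fun w : W => F (contr a • I (WithLp.toLp 2 (a, ‖w‖⁻¹ • w))) :=
    hjoint.comp measurable_prodMk_left
  have hc := contr_pos a
  rw [lintegral_eq_ofReal_mul_lintegral_smul (by fun_prop) hc, ← lintegral_const_mul']
  · refine lintegral_congr fun w => ?_
    have h1 : ‖contr a • w‖⁻¹ • contr a • w = ‖w‖⁻¹ • w := by
      rw [norm_smul, Real.norm_of_nonneg hc.le, smul_smul]
      congr 1
      field_simp
    have h2 : ‖contr a • w‖ * (contr a)⁻¹ = ‖w‖ := by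
      rw [norm_smul, Real.norm_of_nonneg hc.le]; field_simp
    rw [h1, h2, hdim, pow_add, ENNReal.ofReal_mul (by positivity)]
    ring
  · exact ENNReal.ofReal_ne_top

end PolarSlicing

section SphereRepresentation

variable {A V W : Type*} [NormedAddCommGroup A] [InnerProductSpace ℝ A] [FiniteDimensional ℝ A]
  [NormedAddCommGroup V] [InnerProductSpace ℝ V] [FiniteDimensional ℝ V]
  [NormedAddCommGroup W] [InnerProductSpace ℝ W] [FiniteDimensional ℝ W]
  [MeasurableSpace A] [BorelSpace A] [MeasurableSpace V] [BorelSpace V]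
  [MeasurableSpace W] [BorelSpace W]

lemma rotInv_volume : RotInv (volume : Measure V) := fun L => L.measurePreserving.map_eq

lemma rotInv_stdGaussian : RotInv (ProbabilityTheory.stdGaussian V) :=
  fun L => ProbabilityTheory.stdGaussian_map L

omit [FiniteDimensional ℝ V] in
lemma RotInv.map_normalize {μ : Measure V} (hμ : RotInv μ) :
    RotInv (μ.map fun x => ‖x‖⁻¹ • x) := by
  have hn : Measurable fun x : V => ‖x‖ := continuous_norm.measurable
  intro L
  have hL : Measurable L := L.continuous.measurable
  by_cases hs : AEMeasurable (fun x : V => ‖x‖⁻¹ • x) μ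
  · have hs' : AEMeasurable (fun x : V => ‖x‖⁻¹ • x) (μ.map L) := by rwa [hμ L]
    rw [AEMeasurable.map_map_of_aemeasurable hL.aemeasurable hs]
    conv_rhs => rw [← hμ L, AEMeasurable.map_map_of_aemeasurable hs' hL.aemeasurable]
    congr 1
    ext x
    simp
  · rw [Measure.map_of_not_aemeasurable hs]
    simp

omit [FiniteDimensional ℝ V] in
lemma RotInv.withDensity_norm {μ : Measure V} (hμ : RotInv μ) {f : ℝ → ENNReal}
    (hf : Measurable f) : RotInv (μ.withDensity fun x => f ‖x‖) := by
  intro L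
  have hL : Measurable L := L.continuous.measurable
  have hn : Measurable fun x : V => f ‖x‖ := hf.comp continuous_norm.measurable
  ext s hs
  rw [Measure.map_apply hL hs, withDensity_apply _ (hL hs), withDensity_apply _ hs]
  conv_rhs => rw [← hμ L, setLIntegral_map hs hn hL]
  simp

omit [FiniteDimensional ℝ V] in
lemma ae_norm_eq_one_map_normalize [SecondCountableTopology V] {μ : Measure V}
    (h0 : ∀ᵐ x ∂μ, x ≠ 0) :
    ∀ᵐ x ∂(μ.map fun x => ‖x‖⁻¹ • x), ‖x‖ = 1 := by
  rw [ae_map_iff (by fun_prop) (measurableSet_eq_fun (by fun_prop) (by fun_prop))]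
  filter_upwards [h0] with x hx
  rw [norm_smul, norm_inv, norm_norm, inv_mul_cancel₀ (norm_ne_zero_iff.2 hx)]

/-- The law of the direction of a standard Gaussian vector. -/
noncomputable def dirLaw (W : Type*) [NormedAddCommGroup W] [InnerProductSpace ℝ W]
    [FiniteDimensional ℝ W] [MeasurableSpace W] [BorelSpace W] : Measure W :=
  (ProbabilityTheory.stdGaussian W).map fun w => ‖w‖⁻¹ • w

instance : IsProbabilityMeasure (dirLaw W) :=
  Measure.isProbabilityMeasure_map (by fun_prop)

lemma rotInv_dirLaw : RotInv (dirLaw W) := rotInv_stdGaussian.map_normalize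

lemma stdGaussian_ae_ne_zero [Nontrivial W] :
    ∀ᵐ w ∂(ProbabilityTheory.stdGaussian W), w ≠ 0 := by
  have hpos : 0 < Module.finrank ℝ W := Module.finrank_pos
  let i : Fin (Module.finrank ℝ W) := ⟨0, hpos⟩
  set b := stdOrthonormalBasis ℝ W
  rw [ProbabilityTheory.stdGaussian_eq_map_pi_orthonormalBasis b,
    ae_map_iff (p := fun w => w ≠ 0) (Measurable.aemeasurable (by fun_prop))
      (measurableSet_singleton (0 : W)).compl]
  have h := (measurePreserving_eval (fun _ : Fin (Module.finrank ℝ W) =>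
    ProbabilityTheory.gaussianReal 0 1) i)
  have h1 : ∀ᵐ t ∂(ProbabilityTheory.gaussianReal 0 1), t ≠ 0 := by
    have := ProbabilityTheory.nullSingletonClass_gaussianReal (μ := 0) (v := 1) one_ne_zero
    exact Measure.ae_ne _ 0
  rw [← h.map_eq] at h1
  have h2 := ae_of_ae_map h.measurable.aemeasurable h1
  filter_upwards [h2] with x hx h0
  apply hx
  have := congrArg (fun w => inner ℝ (b i) w) h0
  simpa [inner_sum, inner_smul_right, orthonormal_iff_ite.1 b.orthonormal] using this

lemma ae_norm_eq_one_dirLaw [Nontrivial W] : ∀ᵐ w ∂(dirLaw W), ‖w‖ = 1 :=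
  ae_norm_eq_one_map_normalize stdGaussian_ae_ne_zero

lemma isFiniteMeasure_withDensity_contr {N : ℕ} (hN : Module.finrank ℝ A < N) :
    IsFiniteMeasure ((volume : Measure A).withDensity fun a => ENNReal.ofReal (contr a ^ N)) := by
  refine isFiniteMeasure_withDensity_ofReal ?_
  have := (integrable_rpow_neg_one_add_norm_sq (E := A) (μ := volume) (r := N)
    (by exact_mod_cast hN)).2
  convert this using 2 with a
  rw [contr, inv_pow, Real.sqrt_eq_rpow, ← Real.rpow_natCast, ← Real.rpow_mul (by positivity),
    ← Real.rpow_neg (by positivity)]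
  congr 1
  ring

/-- The unique rotation invariant measure on the unit sphere, in the coordinates of an isometric
splitting. -/
lemma RotInv.eq_smul_map [Nontrivial W] (I : WithLp 2 (A × W) ≃ₗᵢ[ℝ] V) {σ : Measure V}
    [IsFiniteMeasure σ] (hσ : RotInv σ) (hσ1 : ∀ᵐ x ∂σ, ‖x‖ = 1) :
    ∃ c : ENNReal, c ≠ ⊤ ∧ σ = c • (((volume : Measure A).withDensity fun a =>
      ENNReal.ofReal (contr a ^ Module.finrank ℝ V)).prod (dirLaw W)).map
        fun p => contr p.1 • I (WithLp.toLp 2 p) := by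
  have hdim : Module.finrank ℝ V = Module.finrank ℝ A + Module.finrank ℝ W := by
    rw [← I.toLinearEquiv.finrank_eq, (WithLp.linearEquiv 2 ℝ (A × W)).finrank_eq,
      Module.finrank_prod]
  have hWpos : 0 < Module.finrank ℝ W := Module.finrank_pos
  have : Nontrivial V := Module.nontrivial_of_finrank_pos (R := ℝ) (by omega)
  set N := Module.finrank ℝ V with hN
  set k := Module.finrank ℝ A with hk
  let lam := (volume : Measure A).withDensity fun a => ENNReal.ofReal (contr a ^ N)
  have : IsFiniteMeasure lam := isFiniteMeasure_withDensity_contr (by omega)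
  let g : ℝ → ENNReal := (Set.Iic 1).indicator 1
  have hg : Measurable g := measurable_one.indicator measurableSet_Iic
  let Θ : A × W → V := fun p => contr p.1 • I (WithLp.toLp 2 p)
  have hI : Measurable (I : WithLp 2 (A × W) → V) := I.continuous.measurable
  have hΘ : Measurable Θ := by
    have : Measurable fun p : A × W => I (WithLp.toLp 2 p) := hI.comp (by fun_prop)
    fun_prop
  let κ₀ := (volume : Measure W).withDensity fun w => g ‖w‖
  let κ := κ₀.map fun w => ‖w‖⁻¹ • w
  have hκ₀ : κ₀ Set.univ = volume (Metric.closedBall (0 : W) 1) := by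
    rw [withDensity_apply _ MeasurableSet.univ, setLIntegral_univ,
      ← lintegral_indicator_one measurableSet_closedBall]
    congr 1 with w
    by_cases h : ‖w‖ ≤ 1 <;> simp [g, Set.indicator, h]
  have : IsFiniteMeasure κ₀ := ⟨by rw [hκ₀]; exact measure_closedBall_lt_top⟩
  have hκ0 : κ Set.univ ≠ 0 := by
    rw [Measure.map_apply (by fun_prop) MeasurableSet.univ, Set.preimage_univ, hκ₀]
    exact (Metric.measure_closedBall_pos _ _ one_pos).ne'
  have hκ : κ = (κ Set.univ) • dirLaw W := by
    have h1 : RotInv κ := (rotInv_volume.withDensity_norm hg).map_normalize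
    have h2 : ∀ᵐ w ∂κ, ‖w‖ = 1 :=
      ae_norm_eq_one_map_normalize
        ((withDensity_absolutelyContinuous _ _).ae_le (Measure.ae_ne volume (0 : W)))
    simpa using h1.smul_eq_smul rotInv_dirLaw h2 ae_norm_eq_one_dirLaw
  let q : ℝ → ENNReal := fun r => ENNReal.ofReal (r⁻¹ ^ k) * g r
  have hq : Measurable q := by fun_prop
  let M := ((volume : Measure V).withDensity fun x => q ‖x‖).map fun x => ‖x‖⁻¹ • x
  have hM : M = (lam.prod κ).map Θ := by
    ext s hs
    have hF : Measurable (s.indicator (1 : V → ENNReal)) := measurable_one.indicator hs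
    have h1 := lintegral_direction_eq I hF hg
    rw [← lintegral_indicator_one hs, ← lintegral_indicator_one hs,
      lintegral_map hF (by fun_prop), lintegral_map hF hΘ,
      lintegral_withDensity_eq_lintegral_mul _ (by fun_prop) (by fun_prop),
      lintegral_prod (fun z => s.indicator (1 : V → ENNReal) (Θ z)) (hF.comp hΘ).aemeasurable,
      lintegral_withDensity_eq_lintegral_mul (g := fun a => ∫⁻ w, s.indicator (1 : V → ENNReal)
        (Θ (a, w)) ∂κ) _ (by fun_prop) (hF.comp hΘ).lintegral_prod_right']
    simp only [Pi.mul_apply]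
    rw [show (∫⁻ x : V, q ‖x‖ * s.indicator 1 (‖x‖⁻¹ • x)) = _ from
      (lintegral_congr fun x => mul_comm _ _).trans h1]
    refine lintegral_congr fun a => ?_
    have hFa : Measurable fun w => s.indicator (1 : V → ENNReal) (Θ (a, w)) :=
      hF.comp (hΘ.comp measurable_prodMk_left)
    rw [lintegral_map hFa (by fun_prop), lintegral_withDensity_eq_lintegral_mul
      (g := fun w => s.indicator (1 : V → ENNReal) (Θ (a, ‖w‖⁻¹ • w))) _ (by fun_prop)
      (hFa.comp (by fun_prop)), ← lintegral_const_mul' _ _ ENNReal.ofReal_ne_top]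
    refine lintegral_congr fun w => ?_
    simp only [Pi.mul_apply, Θ]
    ring
  have hMrot : RotInv M := (rotInv_volume.withDensity_norm hq).map_normalize
  have hM1 : ∀ᵐ x ∂M, ‖x‖ = 1 :=
    ae_norm_eq_one_map_normalize
      ((withDensity_absolutelyContinuous _ _).ae_le (Measure.ae_ne volume (0 : V)))
  have : IsFiniteMeasure M := by rw [hM]; infer_instance
  have hlam : lam Set.univ ≠ 0 := by
    rw [withDensity_apply _ MeasurableSet.univ, setLIntegral_univ]
    rw [Ne, lintegral_eq_zero_iff (by fun_prop)]
    intro h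
    have : ∀ᵐ a : A, False := by
      filter_upwards [h] with a ha
      have := pow_pos (contr_pos a) N
      simp only [Pi.zero_apply, ENNReal.ofReal_eq_zero] at ha
      linarith
    exact NeZero.ne (volume : Measure A) (by simpa using this)
  have hMuniv : M Set.univ ≠ 0 := by
    rw [hM, Measure.map_apply hΘ MeasurableSet.univ, Set.preimage_univ,
      ← Set.univ_prod_univ, Measure.prod_prod]
    exact mul_ne_zero hlam hκ0
  have huniq := hσ.smul_eq_smul hMrot hσ1 hM1
  refine ⟨(M Set.univ)⁻¹ * σ Set.univ * κ Set.univ, ?_, ?_⟩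
  · exact ENNReal.mul_ne_top (ENNReal.mul_ne_top (ENNReal.inv_ne_top.2 hMuniv)
      (measure_ne_top _ _)) (measure_ne_top _ _)
  · calc σ = ((M Set.univ)⁻¹ * M Set.univ) • σ := by
          rw [ENNReal.inv_mul_cancel hMuniv (measure_ne_top _ _), one_smul]
      _ = ((M Set.univ)⁻¹ * σ Set.univ) • M := by rw [mul_smul, huniq, ← mul_smul]
      _ = ((M Set.univ)⁻¹ * σ Set.univ) • (lam.prod ((κ Set.univ) • dirLaw W)).map Θ := by
          rw [hM, ← hκ]
      _ = _ := by
          rw [Measure.prod_smul_right, Measure.map_smul, ← mul_smul]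

end SphereRepresentation

section Normalization

variable {α β : Type*} [MeasurableSpace α] [MeasurableSpace β]

/-- The normalization of a measure to total mass one. -/
noncomputable def nrm (μ : Measure α) : Measure α := (μ Set.univ)⁻¹ • μ

lemma isProbabilityMeasure_nrm {μ : Measure α} (h0 : μ Set.univ ≠ 0) (h1 : μ Set.univ ≠ ⊤) :
    IsProbabilityMeasure (nrm μ) :=
  ⟨by rw [nrm, Measure.smul_apply, smul_eq_mul, ENNReal.inv_mul_cancel h0 h1]⟩

lemma nrm_smul (μ : Measure α) {c : ENNReal} (h0 : c ≠ 0) (h1 : c ≠ ⊤) :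
    nrm (c • μ) = nrm μ := by
  rw [nrm, nrm, Measure.smul_apply, smul_eq_mul, ENNReal.mul_inv (Or.inl h0) (Or.inl h1),
    ← mul_smul, mul_right_comm, ENNReal.inv_mul_cancel h0 h1, one_mul]

lemma nrm_map (μ : Measure α) {f : α → β} (hf : Measurable f) :
    nrm (μ.map f) = (nrm μ).map f := by
  rw [nrm, nrm, Measure.map_smul, Measure.map_apply hf MeasurableSet.univ, Set.preimage_univ]

lemma nrm_prod (μ : Measure α) (π : Measure β) [SFinite μ] [IsProbabilityMeasure π] :
    nrm (μ.prod π) = (nrm μ).prod π := by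
  rw [nrm, nrm, Measure.prod_smul_left, ← Set.univ_prod_univ, Measure.prod_prod,
    measure_univ (μ := π), mul_one]

lemma withDensity_map_comp (μ : Measure α) {f : α → β} (hf : Measurable f) {u : β → ENNReal}
    (hu : Measurable u) : (μ.map f).withDensity u = (μ.withDensity (u ∘ f)).map f := by
  ext s hs
  rw [withDensity_apply _ hs, Measure.map_apply hf hs, withDensity_apply _ (hf hs),
    setLIntegral_map hs hu hf]
  rfl

end Normalization

section SphereGibbs

variable {A V W : Type*} [NormedAddCommGroup A] [InnerProductSpace ℝ A] [FiniteDimensional ℝ A]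
  [NormedAddCommGroup V] [InnerProductSpace ℝ V] [FiniteDimensional ℝ V]
  [NormedAddCommGroup W] [InnerProductSpace ℝ W] [FiniteDimensional ℝ W]
  [MeasurableSpace A] [BorelSpace A] [MeasurableSpace V] [BorelSpace V]
  [MeasurableSpace W] [BorelSpace W]

omit [FiniteDimensional ℝ A] [FiniteDimensional ℝ V] [FiniteDimensional ℝ W] in
lemma measurable_contr_smul_splitting [SecondCountableTopology A] [SecondCountableTopology W]
    (I : WithLp 2 (A × W) ≃ₗᵢ[ℝ] V) :
    Measurable fun p : A × W => contr p.1 • I (WithLp.toLp 2 p) := by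
  have hI : Continuous fun p : A × W => I (WithLp.toLp 2 p) :=
    I.continuous.comp (WithLp.prod_continuous_toLp 2 A W)
  exact ((continuous_contr.comp continuous_fst).smul hI).measurable

/-- The density with respect to which the low-dimensional part of a Gibbs measure is defined. -/
noncomputable def gibbsWeight (A : Type*) [NormedAddCommGroup A] [InnerProductSpace ℝ A]
    [FiniteDimensional ℝ A] [MeasurableSpace A] [BorelSpace A] (N : ℕ) (G : A → ℝ) : Measure A :=
  volume.withDensity fun a => ENNReal.ofReal (contr a ^ N * Real.exp (G a))

/-- A Gibbs measure on the sphere whose energy depends only on the `A`-coordinate of an isometric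
splitting. -/
lemma RotInv.nrm_withDensity_eq [Nontrivial W] (I : WithLp 2 (A × W) ≃ₗᵢ[ℝ] V) {σ : Measure V}
    [IsFiniteMeasure σ] (hσ : RotInv σ) (hσ1 : ∀ᵐ x ∂σ, ‖x‖ = 1) (hσ0 : σ ≠ 0)
    {U : V → ℝ} (hU : Measurable U) {G : A → ℝ} (hG : Measurable G)
    (hUG : ∀ p : A × W, U (contr p.1 • I (WithLp.toLp 2 p)) = G p.1) :
    nrm (σ.withDensity fun x => ENNReal.ofReal (Real.exp (U x))) =
      ((nrm (gibbsWeight A (Module.finrank ℝ V) G)).prod (dirLaw W)).map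
        fun p => contr p.1 • I (WithLp.toLp 2 p) := by
  obtain ⟨c, hc, hσc⟩ := hσ.eq_smul_map I hσ1
  have hc0 : c ≠ 0 := by
    rintro rfl
    exact hσ0 (by rw [hσc, zero_smul])
  have hΘ := measurable_contr_smul_splitting I
  have : SFinite (gibbsWeight A (Module.finrank ℝ V) G) := by unfold gibbsWeight; infer_instance
  rw [hσc, withDensity_smul_measure, nrm_smul _ hc0 hc, withDensity_map_comp _ hΘ (by fun_prop),
    nrm_map _ hΘ]
  congr 1
  rw [← nrm_prod]
  congr 1
  have h : ((fun x => ENNReal.ofReal (Real.exp (U x))) ∘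
      fun p : A × W => contr p.1 • I (WithLp.toLp 2 p)) =
      fun p => (fun a => ENNReal.ofReal (Real.exp (G a))) p.1 := by
    ext p
    simp only [Function.comp_apply, hUG]
  rw [h, ← prod_withDensity_left (f := fun a => ENNReal.ofReal (Real.exp (G a))) (by fun_prop),
    gibbsWeight, ← withDensity_mul _ (by fun_prop)
    (by fun_prop)]
  congr 2 with a
  rw [Pi.mul_apply, ← ENNReal.ofReal_mul (pow_nonneg (contr_pos a).le _)]

end SphereGibbs

section SurfaceMeasure

variable (ι : Type*) [Fintype ι]

/-- The surface measure of the unit sphere as a measure on the ambient space. -/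
noncomputable def surf : Measure (EuclideanSpace ℝ ι) :=
  μH[(Fintype.card ι : ℝ) - 1].restrict (Metric.sphere 0 1)

variable [Nonempty ι]

lemma map_val_hausdorffMeasure_sphere :
    (μH[(Fintype.card ι : ℝ) - 1] :
      Measure (Metric.sphere (0 : EuclideanSpace ℝ ι) 1)).map Subtype.val = surf ι := by
  have h : (0 : ℝ) ≤ (Fintype.card ι : ℝ) - 1 := by
    have : 1 ≤ Fintype.card ι := Fintype.card_pos
    rw [sub_nonneg]
    exact_mod_cast this
  rw [isometry_subtype_coe.map_hausdorffMeasure (Or.inl h), Subtype.range_coe, surf]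

instance : IsFiniteMeasure (surf ι) :=
  ⟨by rw [surf, Measure.restrict_apply_univ]; exact hausdorffMeasure_sphere_lt_top⟩

lemma surf_ne_zero : surf ι ≠ 0 := by
  intro h
  have := hausdorffMeasure_sphere_pos (ι := ι)
  rw [← Measure.restrict_apply_univ, ← surf, h] at this
  simp at this

omit [Nonempty ι] in
lemma ae_norm_eq_one_surf : ∀ᵐ x ∂(surf ι), ‖x‖ = 1 := by
  filter_upwards [ae_restrict_mem Metric.isClosed_sphere.measurableSet] with x hx
  simpa using hx

omit [Nonempty ι] in
lemma rotInv_surf : RotInv (surf ι) := by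
  intro L
  have h : (Metric.sphere (0 : EuclideanSpace ℝ ι) 1) = L ⁻¹' Metric.sphere 0 1 := by
    ext x; simp
  have hL : Measurable L := L.continuous.measurable
  conv_lhs => rw [surf, h, ← Measure.restrict_map hL Metric.isClosed_sphere.measurableSet]
  rw [show Measure.map L μH[(Fintype.card ι : ℝ) - 1] = μH[(Fintype.card ι : ℝ) - 1] from
    L.toIsometryEquiv.map_hausdorffMeasure _, surf]

end SurfaceMeasure

section SampleGeometry

/-- The standardized field. -/
noncomputable def eta (d : ℕ) (h : ℕ → Fin d → ℝ) (n : ℕ) (i : ℕ) (j : Fin d) : ℝ :=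
  (h i j - sampleMean d h n j) / sampleStd d h n j

variable {d n : ℕ} {h : ℕ → Fin d → ℝ}

lemma sampleMean_add_sampleStd_mul_eta {j : Fin d} (hs : 0 < sampleStd d h n j) (i : ℕ) :
    sampleMean d h n j + sampleStd d h n j * eta d h n i j = h i j := by
  rw [eta, mul_div_cancel₀ _ hs.ne']
  ring

lemma sum_eta (hn : 0 < n) (j : Fin d) : ∑ i : Fin n, eta d h n i j = 0 := by
  have hn' : (n : ℝ) ≠ 0 := by positivity
  rw [Fin.sum_univ_eq_sum_range (fun i => eta d h n i j)]
  simp only [eta]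
  rw [← Finset.sum_div, Finset.sum_sub_distrib, Finset.sum_const, Finset.card_range,
    nsmul_eq_mul, sampleMean, mul_div_cancel₀ _ hn', sub_self, zero_div]

lemma sum_eta_sq (hn : 0 < n) {j : Fin d} (hs : 0 < sampleStd d h n j) :
    ∑ i : Fin n, eta d h n i j ^ 2 = n := by
  have hn' : (n : ℝ) ≠ 0 := by positivity
  rw [Fin.sum_univ_eq_sum_range (fun i => eta d h n i j ^ 2)]
  have h2 : sampleStd d h n j ^ 2 =
      (∑ i ∈ Finset.range n, (h i j) ^ 2) / n - (sampleMean d h n j) ^ 2 :=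
    Real.sq_sqrt (Real.sqrt_pos.1 hs).le
  have hm : ∑ i ∈ Finset.range n, h i j = n * sampleMean d h n j := by
    rw [sampleMean, mul_div_cancel₀ _ hn']
  simp only [eta, div_pow, sub_sq]
  rw [← Finset.sum_div, div_eq_iff (by positivity), Finset.sum_add_distrib,
    Finset.sum_sub_distrib, Finset.sum_const, Finset.card_range, nsmul_eq_mul, ← Finset.sum_mul,
    ← Finset.mul_sum, hm, h2]
  field_simp
  ring

/-- The isometric embedding of the span of the constant fields and the standardized field. -/
noncomputable def fieldEmbedding (η : ℕ → Fin d → ℝ) (hn : 0 < n)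
    (h0 : ∀ j, ∑ i : Fin n, η i j = 0) (h1 : ∀ j, ∑ i : Fin n, η i j ^ 2 = n) :
    WithLp 2 (EuclideanSpace ℝ (Fin d) × EuclideanSpace ℝ (Fin d)) →ₗᵢ[ℝ]
      EuclideanSpace ℝ (Fin n × Fin d) where
  toFun a := WithLp.toLp 2 fun p => (a.fst p.2 + a.snd p.2 * η p.1 p.2) / Real.sqrt n
  map_add' a b := by
    ext p
    simp only [WithLp.add_fst, WithLp.add_snd, PiLp.add_apply]
    ring
  map_smul' c a := by
    ext p
    simp only [WithLp.smul_fst, WithLp.smul_snd, PiLp.smul_apply, smul_eq_mul, RingHom.id_apply]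
    ring
  norm_map' a := by
    have hn' : (0 : ℝ) < n := by positivity
    rw [← sq_eq_sq₀ (norm_nonneg _) (norm_nonneg _), WithLp.prod_norm_sq_eq_of_L2,
      EuclideanSpace.real_norm_sq_eq, EuclideanSpace.real_norm_sq_eq,
      EuclideanSpace.real_norm_sq_eq, Fintype.sum_prod_type_right, ← Finset.sum_add_distrib]
    refine Finset.sum_congr rfl fun j _ => ?_
    have : ∀ i : Fin n, ((a.fst j + a.snd j * η i j) / Real.sqrt n) ^ 2 =
        (a.fst j ^ 2 + 2 * a.fst j * a.snd j * η i j + a.snd j ^ 2 * η i j ^ 2) / n := by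
      intro i
      rw [div_pow, Real.sq_sqrt hn'.le]
      ring
    simp only [LinearMap.coe_mk, AddHom.coe_mk, this]
    rw [← Finset.sum_div, Finset.sum_add_distrib, Finset.sum_add_distrib, ← Finset.mul_sum,
      ← Finset.mul_sum, h0, h1, Finset.sum_const, Finset.card_univ, Fintype.card_fin, nsmul_eq_mul]
    field_simp
    ring

lemma fieldEmbedding_apply (η : ℕ → Fin d → ℝ) (hn : 0 < n)
    (h0 : ∀ j, ∑ i : Fin n, η i j = 0) (h1 : ∀ j, ∑ i : Fin n, η i j ^ 2 = n)
    (a : WithLp 2 (EuclideanSpace ℝ (Fin d) × EuclideanSpace ℝ (Fin d))) (p : Fin n × Fin d) :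
    fieldEmbedding η hn h0 h1 a p = (a.fst p.2 + a.snd p.2 * η p.1 p.2) / Real.sqrt n :=
  rfl

lemma sum_eq_zero_of_inner_fieldEmbedding (η : ℕ → Fin d → ℝ) (hn : 0 < n)
    (h0 : ∀ j, ∑ i : Fin n, η i j = 0) (h1 : ∀ j, ∑ i : Fin n, η i j ^ 2 = n)
    {K : EuclideanSpace ℝ (Fin n × Fin d)} (hK : ∀ a, inner ℝ (fieldEmbedding η hn h0 h1 a) K = 0)
    (j : Fin d) : ∑ i : Fin n, K (i, j) = 0 ∧ ∑ i : Fin n, η i j * K (i, j) = 0 := by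
  have hn' : (0 : ℝ) < Real.sqrt n := by positivity
  constructor
  · have := hK (WithLp.toLp 2 (EuclideanSpace.single j 1, 0))
    rw [PiLp.inner_apply, Fintype.sum_prod_type_right] at this
    simp only [fieldEmbedding_apply, RCLike.inner_apply, conj_trivial] at this
    rw [Finset.sum_eq_single j (by intro k _ hk; simp [hk]) (by simp)] at this
    simpa [← Finset.sum_div, div_eq_mul_inv, ← Finset.sum_mul, hn'.ne', hn.ne'] using this
  · have := hK (WithLp.toLp 2 (0, EuclideanSpace.single j 1))
    rw [PiLp.inner_apply, Fintype.sum_prod_type_right] at this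
    simp only [fieldEmbedding_apply, RCLike.inner_apply, conj_trivial] at this
    rw [Finset.sum_eq_single j (by intro k _ hk; simp [hk]) (by simp)] at this
    have e : ∑ i : Fin n, η i j * K (i, j) =
        Real.sqrt n * ∑ i : Fin n, K (i, j) * ((0 + 1 * η i j) / Real.sqrt n) := by
      rw [Finset.mul_sum]
      refine Finset.sum_congr rfl fun i _ => ?_
      field_simp
      ring
    rw [e, mul_eq_zero]
    exact Or.inr (by simpa using this)

/-- The exponent of the Gibbs weight in low-dimensional coordinates. -/
noncomputable def fieldExponent {E : Type*} [NormedAddCommGroup E] [InnerProductSpace ℝ E]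
    (n : ℕ) (β : ℝ) (m s : E) (a : WithLp 2 (E × E)) : ℝ :=
  n * β * (‖contr a • a.fst‖ ^ 2 / 2 + inner ℝ m (contr a • a.fst) +
    inner ℝ s (contr a • a.snd))

@[fun_prop]
lemma continuous_fieldExponent {E : Type*} [NormedAddCommGroup E] [InnerProductSpace ℝ E]
    (n : ℕ) (β : ℝ) (m s : E) : Continuous (fieldExponent n β m s) := by
  unfold fieldExponent
  have h1 : Continuous fun a : WithLp 2 (E × E) => a.fst := WithLp.continuous_fst ..
  have h2 : Continuous fun a : WithLp 2 (E × E) => a.snd := WithLp.continuous_snd ..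
  fun_prop

lemma neg_mul_Hn_eq (β : ℝ) (hn : 0 < n) (φ : Fin n → Fin d → ℝ) (x y : Fin d → ℝ)
    (hs : ∀ j, 0 < sampleStd d h n j) (hx : ∀ j, ∑ i, φ i j = n * x j)
    (hy : ∀ j, ∑ i : Fin n, eta d h n i j * φ i j = n * y j) :
    -β * Hn d n h φ =
      n * β * (ip x x / 2 + ip (sampleMean d h n) x + ip (sampleStd d h n) y) := by
  have hn' : (n : ℝ) ≠ 0 := by positivity
  have h1 : ∑ i : Fin n, ∑ i' : Fin n, ip (φ i) (φ i') = n ^ 2 * ip x x := by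
    simp only [ip]
    have : ∀ i : Fin n, ∑ i' : Fin n, ∑ j, φ i j * φ i' j = ∑ j, φ i j * (n * x j) := by
      intro i
      rw [Finset.sum_comm]
      exact Finset.sum_congr rfl fun j _ => by rw [← Finset.mul_sum, hx]
    simp only [this]
    rw [Finset.sum_comm, Finset.mul_sum]
    refine Finset.sum_congr rfl fun j _ => ?_
    rw [← Finset.sum_mul, hx]
    ring
  have h2 : ∑ i : Fin n, ip (h i) (φ i) =
      n * (ip (sampleMean d h n) x + ip (sampleStd d h n) y) := by
    simp only [ip]
    rw [Finset.sum_comm, ← Finset.sum_add_distrib, Finset.mul_sum]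
    refine Finset.sum_congr rfl fun j _ => ?_
    have : ∀ i : Fin n, h i j * φ i j = sampleMean d h n j * φ i j +
        sampleStd d h n j * (eta d h n i j * φ i j) := by
      intro i
      rw [← sampleMean_add_sampleStd_mul_eta (hs j) i]
      simp only [eta]
      ring
    simp only [this]
    rw [Finset.sum_add_distrib, ← Finset.mul_sum, ← Finset.mul_sum, hx, hy]
    ring
  rw [Hn, h1, h2]
  field_simp
  ring

end SampleGeometry

section GibbsRepresentation

variable {d n : ℕ} {h : ℕ → Fin d → ℝ}

/-- The configuration obtained from a unit vector by rescaling and extension by zero. -/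
noncomputable def extendCfg (d n : ℕ) (x : EuclideanSpace ℝ (Fin n × Fin d)) :
    ℕ → Fin d → ℝ :=
  fun i j => if hi : i < n then Real.sqrt n * x (⟨i, hi⟩, j) else 0

@[fun_prop]
lemma measurable_extendCfg : Measurable (extendCfg d n) := by
  refine measurable_pi_iff.2 fun i => measurable_pi_iff.2 fun j => ?_
  by_cases hi : i < n
  · simp only [extendCfg, hi, dite_true]
    fun_prop
  · simp [extendCfg, hi]

/-- The two-block space of magnetization and staggered magnetization. -/
abbrev MagSpace (d : ℕ) := WithLp 2 (EuclideanSpace ℝ (Fin d) × EuclideanSpace ℝ (Fin d))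

lemma finrank_magSpace : Module.finrank ℝ (MagSpace d) = 2 * d := by
  rw [(WithLp.linearEquiv 2 ℝ (EuclideanSpace ℝ (Fin d) × EuclideanSpace ℝ (Fin d))).finrank_eq,
    Module.finrank_prod, finrank_euclideanSpace, Fintype.card_fin, two_mul]

/-- The low-dimensional law of the Gibbs state. -/
noncomputable def magLaw (d n : ℕ) (β : ℝ) (h : ℕ → Fin d → ℝ) : Measure (MagSpace d) :=
  nrm (gibbsWeight (MagSpace d) (n * d) (fieldExponent n β (WithLp.toLp 2 (sampleMean d h n))
    (WithLp.toLp 2 (sampleStd d h n))))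

lemma euclidean_inner_eq_ip (x y : EuclideanSpace ℝ (Fin d)) : inner ℝ x y = ip x y := by
  rw [PiLp.inner_apply, ip]
  exact Finset.sum_congr rfl fun j _ => by simp [mul_comm]

lemma gibbs_eq (hd : 1 ≤ d) (hn : 3 ≤ n) (β : ℝ) (hs : ∀ j, 0 < sampleStd d h n j) {M : ℕ}
    (hM : M + 2 * d = n * d)
    (I : WithLp 2 (MagSpace d × EuclideanSpace ℝ (Fin M)) ≃ₗᵢ[ℝ] EuclideanSpace ℝ (Fin n × Fin d))
    (hI : ∀ a p, I (WithLp.toLp 2 (a, 0)) p =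
      (a.fst p.2 + a.snd p.2 * eta d h n p.1 p.2) / Real.sqrt n) :
    gibbs d n β h = ((magLaw d n β h).prod (dirLaw (EuclideanSpace ℝ (Fin M)))).map
      fun p => extendCfg d n (contr p.1 • I (WithLp.toLp 2 p)) := by
  have hn0 : 0 < n := by omega
  have hn' : (0 : ℝ) < n := by positivity
  have : Nonempty (Fin n × Fin d) := ⟨(⟨0, hn0⟩, ⟨0, hd⟩)⟩
  have hMpos : 0 < M := by nlinarith
  have : Nontrivial (EuclideanSpace ℝ (Fin M)) :=
    Module.nontrivial_of_finrank_pos (R := ℝ) (by simpa using hMpos)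
  let J := fieldEmbedding (eta d h n) hn0 (sum_eta hn0) fun j => sum_eta_sq hn0 (hs j)
  have hIJ : ∀ a, I (WithLp.toLp 2 (a, 0)) = J a := fun a => by
    ext p
    rw [hI, fieldEmbedding_apply]
  let U : EuclideanSpace ℝ (Fin n × Fin d) → ℝ := fun x =>
    -β * Hn d n h fun i j => Real.sqrt n * x (i, j)
  have hU : Measurable U := by
    simp only [U, Hn, ip]
    fun_prop
  have hUG : ∀ p : MagSpace d × EuclideanSpace ℝ (Fin M),
      U (contr p.1 • I (WithLp.toLp 2 p)) = fieldExponent n β (WithLp.toLp 2 (sampleMean d h n))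
        (WithLp.toLp 2 (sampleStd d h n)) p.1 := by
    rintro ⟨a, u⟩
    have hsplit : I (WithLp.toLp 2 (a, u)) = J a + I (WithLp.toLp 2 (0, u)) := by
      rw [← hIJ, ← map_add, ← WithLp.toLp_add, Prod.mk_add_mk, add_zero, zero_add]
    have hK : ∀ b, inner ℝ (J b) (I (WithLp.toLp 2 (0, u))) = 0 := fun b => by
      rw [← hIJ, I.inner_map_map, WithLp.prod_inner_apply]
      simp
    have hK' := sum_eq_zero_of_inner_fieldEmbedding _ hn0 _ _ hK
    simp only [U, fieldExponent]
    rw [neg_mul_Hn_eq β hn0 _ (fun j => contr a * a.fst j) (fun j => contr a * a.snd j) hs]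
    · rw [← real_inner_self_eq_norm_sq, euclidean_inner_eq_ip, euclidean_inner_eq_ip,
        euclidean_inner_eq_ip]
      rfl
    · intro j
      have e : ∀ i : Fin n, Real.sqrt n * (contr a • I (WithLp.toLp 2 (a, u))) (i, j) =
          contr a * a.fst j + contr a * a.snd j * eta d h n i j +
            Real.sqrt n * contr a * I (WithLp.toLp 2 (0, u)) (i, j) := by
        intro i
        simp only [hsplit, PiLp.smul_apply, PiLp.add_apply, J, fieldEmbedding_apply, smul_eq_mul]
        field_simp
      simp only [e]
      rw [Finset.sum_add_distrib, Finset.sum_add_distrib, ← Finset.mul_sum, ← Finset.mul_sum,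
        ← Finset.mul_sum, (hK' j).1, sum_eta hn0, Finset.sum_const, Finset.card_univ, Fintype.card_fin,
        nsmul_eq_mul]
      ring
    · intro j
      have e : ∀ i : Fin n, eta d h n i j *
          (Real.sqrt n * (contr a • I (WithLp.toLp 2 (a, u))) (i, j)) =
          contr a * a.fst j * eta d h n i j + contr a * a.snd j * eta d h n i j ^ 2 +
            Real.sqrt n * contr a * (eta d h n i j * I (WithLp.toLp 2 (0, u)) (i, j)) := by
        intro i
        simp only [hsplit, PiLp.smul_apply, PiLp.add_apply, J, fieldEmbedding_apply, smul_eq_mul]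
        field_simp
      simp only [e]
      rw [Finset.sum_add_distrib, Finset.sum_add_distrib, ← Finset.mul_sum, ← Finset.mul_sum,
        ← Finset.mul_sum, (hK' j).2, sum_eta hn0, sum_eta_sq hn0 (hs j)]
      ring
  have hcard : ((n * d : ℕ) : ℝ) = (Fintype.card (Fin n × Fin d) : ℝ) := by simp
  have hmain := rotInv_surf (Fin n × Fin d) |>.nrm_withDensity_eq I (ae_norm_eq_one_surf _)
    (surf_ne_zero _) hU (by fun_prop) hUG
  rw [finrank_euclideanSpace, Fintype.card_prod, Fintype.card_fin, Fintype.card_fin,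
    ← map_val_hausdorffMeasure_sphere, withDensity_map_comp _ measurable_subtype_coe (by fun_prop),
    nrm_map _ measurable_subtype_coe] at hmain
  have hΘ := measurable_contr_smul_splitting I
  rw [show (fun p : MagSpace d × EuclideanSpace ℝ (Fin M) =>
    extendCfg d n (contr p.1 • I (WithLp.toLp 2 p))) = extendCfg d n ∘ fun p =>
      contr p.1 • I (WithLp.toLp 2 p) from rfl, ← Measure.map_map measurable_extendCfg hΘ, magLaw,
    ← hmain, Measure.map_map measurable_extendCfg measurable_subtype_coe, gibbs, hcard]
  rfl

end GibbsRepresentation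

section Laplace

variable {α : Type*} [MeasurableSpace α] {μ : Measure α} {D : α → ℝ}

lemma withDensity_exp_superlevel_le (hD : Measurable D) {k n : ℕ} (hkn : k ≤ n) {c δ η : ℝ}
    (hc : 0 < c) {e : α → ℝ} (he : ∀ a, |e a| ≤ δ) :
    (μ.withDensity fun a => ENNReal.ofReal (c * Real.exp (n * (e a - D a)))) {a | η ≤ D a} ≤
      ENNReal.ofReal (c * Real.exp (n * δ - (n - k : ℝ) * η)) *
        ∫⁻ a, ENNReal.ofReal (Real.exp (-(k * D a))) ∂μ := by
  have hS : MeasurableSet {a | η ≤ D a} := measurableSet_le measurable_const hD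
  rw [withDensity_apply _ hS, ← lintegral_const_mul' _ _ ENNReal.ofReal_ne_top]
  refine (setLIntegral_mono' hS fun a ha => ?_).trans (setLIntegral_le_lintegral _ _)
  rw [← ENNReal.ofReal_mul (by positivity), mul_assoc, ← Real.exp_add]
  gcongr
  have ha' : η ≤ D a := ha
  have hkn' : (k : ℝ) ≤ n := by exact_mod_cast hkn
  have h1 : e a ≤ δ := (abs_le.1 (he a)).2
  nlinarith [mul_le_mul_of_nonneg_left ha' (sub_nonneg.2 hkn'),
    mul_le_mul_of_nonneg_left h1 (Nat.cast_nonneg (α := ℝ) n)]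

lemma le_withDensity_exp_univ (hD : Measurable D) {n : ℕ} {c δ η : ℝ} (hc : 0 < c) {e : α → ℝ}
    (he : ∀ a, |e a| ≤ δ) :
    ENNReal.ofReal (c * Real.exp (-(n * δ) - n * η)) * μ {a | D a < η} ≤
      (μ.withDensity fun a => ENNReal.ofReal (c * Real.exp (n * (e a - D a)))) Set.univ := by
  have hS : MeasurableSet {a | D a < η} := measurableSet_lt hD measurable_const
  refine le_trans ?_ (measure_mono (Set.subset_univ {a | D a < η}))
  rw [withDensity_apply _ hS, ← setLIntegral_const]
  refine setLIntegral_mono' hS fun a ha => ?_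
  gcongr
  have ha' : D a < η := ha
  have h1 : -δ ≤ e a := (abs_le.1 (he a)).1
  have hn : (0 : ℝ) ≤ n := Nat.cast_nonneg n
  nlinarith [mul_le_mul_of_nonneg_left ha'.le hn, mul_le_mul_of_nonneg_left h1 hn]

lemma withDensity_exp_univ_ne_top (hD : Measurable D) (hD0 : ∀ a, 0 ≤ D a) {k n : ℕ} (hkn : k ≤ n)
    (hk : ∫⁻ a, ENNReal.ofReal (Real.exp (-(k * D a))) ∂μ ≠ ⊤) {c δ : ℝ}
    (hc : 0 < c) {e : α → ℝ} (he : ∀ a, |e a| ≤ δ) :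
    (μ.withDensity fun a => ENNReal.ofReal (c * Real.exp (n * (e a - D a)))) Set.univ ≠ ⊤ := by
  have h := withDensity_exp_superlevel_le (μ := μ) (η := 0) hD hkn hc he
  rw [show {a | 0 ≤ D a} = Set.univ from Set.eq_univ_of_forall hD0] at h
  exact ne_top_of_le_ne_top (ENNReal.mul_ne_top ENNReal.ofReal_ne_top hk) h

lemma withDensity_exp_univ_ne_zero (hD : Measurable D) (hpos : ∀ η > 0, μ {a | D a < η} ≠ 0)
    {n : ℕ} {c δ : ℝ} (hc : 0 < c) {e : α → ℝ} (he : ∀ a, |e a| ≤ δ) :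
    (μ.withDensity fun a => ENNReal.ofReal (c * Real.exp (n * (e a - D a)))) Set.univ ≠ 0 := by
  have h := le_withDensity_exp_univ (μ := μ) (η := 1) (n := n) hD hc he
  refine (lt_of_lt_of_le (pos_iff_ne_zero.2 (mul_ne_zero ?_ (hpos 1 one_pos))) h).ne'
  exact (ENNReal.ofReal_pos.2 (by positivity)).ne'

/-- Laplace's principle: the normalized measures with density proportional to
`exp (n (e - D))` concentrate where `D` is minimal. -/
lemma tendsto_nrm_withDensity_exp_superlevel (hD : Measurable D) {k : ℕ}
    (hk : ∫⁻ a, ENNReal.ofReal (Real.exp (-(k * D a))) ∂μ ≠ ⊤)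
    (hpos : ∀ η > 0, μ {a | D a < η} ≠ 0) {c δ : ℕ → ℝ} (hc : ∀ n, 0 < c n) {e : ℕ → α → ℝ}
    (he : ∀ n a, |e n a| ≤ δ n) (hδ : Tendsto δ atTop (𝓝 0)) {η : ℝ} (hη : 0 < η) :
    Tendsto (fun n : ℕ => nrm (μ.withDensity fun a =>
      ENNReal.ofReal (c n * Real.exp (n * (e n a - D a)))) {a | η ≤ D a}) atTop (𝓝 0) := by
  set B := ∫⁻ a, ENNReal.ofReal (Real.exp (-(k * D a))) ∂μ
  set v := μ {a | D a < η / 4}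
  have hv : v ≠ 0 := hpos _ (by positivity)
  have hlim : Tendsto (fun n : ℕ => ENNReal.ofReal (Real.exp (n * (2 * δ n - 3 / 4 * η) + k * η)) *
      (B * v⁻¹)) atTop (𝓝 0) := by
    have h1 : Tendsto (fun n : ℕ => Real.exp (n * (2 * δ n - 3 / 4 * η) + k * η)) atTop (𝓝 0) := by
      refine Real.tendsto_exp_atBot.comp (tendsto_atBot_add_const_right _ _ ?_)
      have h2 : Tendsto (fun n => 2 * δ n - 3 / 4 * η) atTop (𝓝 (2 * 0 - 3 / 4 * η)) :=
        (hδ.const_mul 2).sub_const _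
      exact tendsto_natCast_atTop_atTop.atTop_mul_neg (by linarith) h2
    have h3 := ENNReal.tendsto_ofReal h1
    rw [ENNReal.ofReal_zero] at h3
    have h4 := ENNReal.Tendsto.mul_const (b := B * v⁻¹) h3
      (Or.inr (ENNReal.mul_ne_top hk (ENNReal.inv_ne_top.2 hv)))
    rwa [zero_mul] at h4
  refine tendsto_of_tendsto_of_tendsto_of_le_of_le' tendsto_const_nhds hlim
    (Eventually.of_forall fun n => zero_le) ?_
  filter_upwards [eventually_ge_atTop k] with n hn
  rw [nrm, Measure.smul_apply, smul_eq_mul]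
  have hup := withDensity_exp_superlevel_le (μ := μ) (η := η) hD hn (hc n) (he n)
  have hlow := le_withDensity_exp_univ (μ := μ) (η := η / 4) (n := n) hD (hc n) (he n)
  have hA : 0 < c n * Real.exp (-(n * δ n) - n * (η / 4)) := mul_pos (hc n) (Real.exp_pos _)
  refine (mul_le_mul' (ENNReal.inv_le_inv.2 hlow) hup).trans (le_of_eq ?_)
  rw [ENNReal.mul_inv (Or.inl (ENNReal.ofReal_pos.2 hA).ne') (Or.inl ENNReal.ofReal_ne_top),
    ← ENNReal.ofReal_inv_of_pos hA]
  rw [show ∀ x y z t : ENNReal, x * y * (z * t) = z * x * (t * y) from fun x y z t => by ring,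
    ← ENNReal.ofReal_mul (mul_pos (hc n) (Real.exp_pos _)).le]
  congr 2
  rw [mul_inv, ← Real.exp_neg]
  have := (hc n).ne'
  rw [show ∀ x y z t : ℝ, x * y * (z * t) = (x * z) * (y * t) from fun x y z t => by ring,
    mul_inv_cancel₀ this, one_mul, ← Real.exp_add]
  congr 1
  ring

lemma tendsto_integral_of_tendsto_measure {α : ℕ → Type*} [∀ n, MeasurableSpace (α n)]
    {P : ∀ n, Measure (α n)} (hP : ∀ᶠ n in atTop, IsProbabilityMeasure (P n)) {f : ∀ n, α n → ℝ}
    (hf : ∀ n, Measurable (f n)) {C : ℝ} (h0 : ∀ n a, 0 ≤ f n a) (hC : ∀ n a, f n a ≤ C)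
    (h : ∀ ε > 0, Tendsto (fun n => P n {a | ε ≤ f n a}) atTop (𝓝 0)) :
    Tendsto (fun n => ∫ a, f n a ∂(P n)) atTop (𝓝 0) := by
  have hC1 : 0 < max C 1 := by positivity
  rw [Metric.tendsto_atTop']
  intro ε hε
  have h1 := (ENNReal.tendsto_nhds_zero.1 (h (ε / 2) (by positivity))
    (ENNReal.ofReal (ε / 4 / max C 1)) (ENNReal.ofReal_pos.2 (by positivity)))
  obtain ⟨N, hN⟩ := eventually_atTop.1 (hP.and h1)
  refine ⟨N, fun n hn => ?_⟩
  obtain ⟨_, h2⟩ := hN n hn.le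
  have hS : MeasurableSet {a | ε / 2 ≤ f n a} := measurableSet_le measurable_const (hf n)
  have h3 : (P n).real {a | ε / 2 ≤ f n a} ≤ ε / 4 / max C 1 :=
    ENNReal.toReal_le_of_le_ofReal (by positivity) h2
  rw [Real.dist_0_eq_abs, abs_of_nonneg (integral_nonneg (h0 n))]
  have hle : ∀ a, f n a ≤ ε / 2 + {a | ε / 2 ≤ f n a}.indicator (fun _ => max C 1) a := by
    intro a
    by_cases ha : ε / 2 ≤ f n a
    · rw [Set.indicator_of_mem (by exact ha)]
      have := (hC n a).trans (le_max_left C 1)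
      linarith
    · rw [Set.indicator_of_notMem (by exact ha)]
      linarith
  have hfint : Integrable (fun a => ε / 2 + {a | ε / 2 ≤ f n a}.indicator (fun _ => max C 1) a)
      (P n) := (integrable_const _).add ((integrable_const _).indicator hS)
  calc ∫ a, f n a ∂(P n) ≤ ∫ a, ε / 2 + {a | ε / 2 ≤ f n a}.indicator (fun _ => max C 1) a ∂(P n) :=
        integral_mono_of_nonneg (Eventually.of_forall (h0 n)) hfint (Eventually.of_forall hle)
    _ = ε / 2 + (P n).real {a | ε / 2 ≤ f n a} * max C 1 := by
        rw [integral_add (integrable_const _) ((integrable_const _).indicator hS),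
          integral_indicator_const _ hS]
        simp
    _ ≤ ε / 2 + ε / 4 / max C 1 * max C 1 := by gcongr
    _ < ε := by
        rw [div_mul_cancel₀ _ hC1.ne']
        linarith

end Laplace

section RateFunction

variable {E : Type*} [NormedAddCommGroup E] [InnerProductSpace ℝ E]

lemma contr_sq_eq (a : WithLp 2 (E × E)) :
    contr a ^ 2 = 1 - ‖contr a • a.fst‖ ^ 2 - ‖contr a • a.snd‖ ^ 2 := by
  have h : 0 < 1 + ‖a‖ ^ 2 := by positivity
  have h1 : contr a ^ 2 * (1 + ‖a‖ ^ 2) = 1 := by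
    rw [contr, inv_pow, Real.sq_sqrt h.le, inv_mul_cancel₀ h.ne']
  rw [WithLp.prod_norm_sq_eq_of_L2] at h1
  simp only [norm_smul, mul_pow, Real.norm_of_nonneg (contr_pos a).le]
  linarith

lemma norm_contr_smul_fst_le (a : WithLp 2 (E × E)) : ‖contr a • a.fst‖ ≤ 1 := by
  have := contr_sq_eq a
  nlinarith [sq_nonneg (contr a), sq_nonneg ‖contr a • a.snd‖, norm_nonneg (contr a • a.fst)]

lemma norm_contr_smul_snd_le (a : WithLp 2 (E × E)) : ‖contr a • a.snd‖ ≤ 1 := by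
  have := contr_sq_eq a
  nlinarith [sq_nonneg (contr a), sq_nonneg ‖contr a • a.fst‖, norm_nonneg (contr a • a.snd)]

lemma contr_le_one (a : WithLp 2 (E × E)) : contr a ≤ 1 := by
  have := contr_sq_eq a
  nlinarith [sq_nonneg ‖contr a • a.snd‖, sq_nonneg ‖contr a • a.fst‖, contr_pos a]

/-- The rate function of the low-dimensional law. -/
noncomputable def magRate (d : ℕ) (β : ℝ) (s : E) (a : WithLp 2 (E × E)) : ℝ :=
  β / 2 * ‖contr a • a.snd - s‖ ^ 2 + d / 2 *
    ((contr a / Real.sqrt (d / β)) ^ 2 - 1 - 2 * Real.log (contr a / Real.sqrt (d / β)))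

variable {d : ℕ} {β : ℝ} {s : E}

lemma continuous_magRate (hd : 0 < d) (hβ : 0 < β) : Continuous (magRate d β s) := by
  have h2 : Continuous fun a : WithLp 2 (E × E) => a.snd := WithLp.continuous_snd ..
  have h3 : Continuous fun a : WithLp 2 (E × E) => Real.log (contr a / Real.sqrt (d / β)) :=
    Continuous.log (by fun_prop) fun a => (div_pos (contr_pos a) (by positivity)).ne'
  unfold magRate
  fun_prop

lemma le_magRate (hd : 0 < d) (hβ : 0 < β) (a : WithLp 2 (E × E)) :
    β / 2 * (‖contr a • a.snd - s‖ ^ 2 + (contr a - Real.sqrt (d / β)) ^ 2) ≤ magRate d β s a := by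
  have hd' : (0 : ℝ) < d := by positivity
  have ht : 0 < Real.sqrt (d / β) := by positivity
  have hsq : Real.sqrt (d / β) ^ 2 = d / β := Real.sq_sqrt (by positivity)
  set v := contr a / Real.sqrt (d / β) with hv
  have hvpos : 0 < v := div_pos (contr_pos a) ht
  have hc : contr a = v * Real.sqrt (d / β) := by rw [hv, div_mul_cancel₀ _ ht.ne']
  have hlog := Real.log_le_sub_one_of_pos hvpos
  have h1 : β / 2 * (contr a - Real.sqrt (d / β)) ^ 2 = d / 2 * (v - 1) ^ 2 := by
    rw [hc, ← sub_one_mul, mul_pow, hsq]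
    field_simp
  have h2 : d / 2 * (v - 1) ^ 2 ≤ d / 2 * (v ^ 2 - 1 - 2 * Real.log v) := by
    gcongr
    linarith
  rw [magRate, mul_add, h1]
  gcongr

lemma magRate_nonneg (hd : 0 < d) (hβ : 0 < β) (a : WithLp 2 (E × E)) :
    0 ≤ magRate d β s a :=
  le_trans (by positivity) (le_magRate hd hβ a)

lemma exists_magRate_eq_zero [Nontrivial E] (hd : 0 < d) (hβ : 0 < β)
    (hs : 0 ≤ 1 - d / β - ‖s‖ ^ 2) : ∃ a : WithLp 2 (E × E), magRate d β s a = 0 := by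
  have ht : 0 < Real.sqrt (d / β) := by positivity
  have hsq : Real.sqrt (d / β) ^ 2 = d / β := Real.sq_sqrt (by positivity)
  obtain ⟨x, hx⟩ := exists_norm_eq E (Real.sqrt_nonneg (1 - d / β - ‖s‖ ^ 2))
  have hx2 : ‖x‖ ^ 2 = 1 - d / β - ‖s‖ ^ 2 := by rw [hx, Real.sq_sqrt hs]
  set t := Real.sqrt (d / β)
  have hc : contr (WithLp.toLp 2 (t⁻¹ • x, t⁻¹ • s)) = t := by
    rw [contr, WithLp.prod_norm_sq_eq_of_L2]
    simp only [WithLp.toLp_fst, WithLp.toLp_snd, norm_smul, mul_pow, norm_inv,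
      Real.norm_of_nonneg ht.le, hx2]
    rw [show 1 + ((t⁻¹) ^ 2 * (1 - d / β - ‖s‖ ^ 2) + (t⁻¹) ^ 2 * ‖s‖ ^ 2) = (t⁻¹) ^ 2 by
      rw [← hsq]; field_simp; ring, Real.sqrt_sq (by positivity), inv_inv]
  refine ⟨WithLp.toLp 2 (t⁻¹ • x, t⁻¹ • s), ?_⟩
  rw [magRate, hc, div_self ht.ne']
  simp [smul_smul, ht.ne']

lemma contr_pow_mul_exp_fieldExponent (hd : 0 < d) (hβ : 0 < β) (n : ℕ) (m t : E)
    (a : WithLp 2 (E × E)) :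
    contr a ^ (n * d) * Real.exp (fieldExponent n β m t a) =
      Real.exp (n * (β / 2 * (1 + ‖s‖ ^ 2) - d / 2 + d * Real.log (Real.sqrt (d / β)))) *
        Real.exp (n * ((β * inner ℝ m (contr a • a.fst) +
          β * inner ℝ (t - s) (contr a • a.snd)) - magRate d β s a)) := by
  have ht : 0 < Real.sqrt (d / β) := by positivity
  have hsq : Real.sqrt (d / β) ^ 2 = d / β := Real.sq_sqrt (by positivity)
  have h1 : contr a ^ (n * d) = Real.exp (n * d * Real.log (contr a)) := by
    rw [mul_comm ((n : ℝ) * d), ← Nat.cast_mul, Real.exp_mul, Real.exp_log (contr_pos a),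
      Real.rpow_natCast]
  rw [h1, ← Real.exp_add, ← Real.exp_add]
  congr 1
  rw [fieldExponent, magRate, Real.log_div (contr_pos a).ne' ht.ne', div_pow, hsq, contr_sq_eq,
    inner_sub_left, norm_sub_sq_real, real_inner_comm s]
  have hd' : (d : ℝ) ≠ 0 := by positivity
  field_simp
  ring

lemma abs_field_error_le (hβ : 0 < β) (m u : E) (a : WithLp 2 (E × E)) :
    |β * inner ℝ m (contr a • a.fst) + β * inner ℝ u (contr a • a.snd)| ≤
      β * (‖m‖ + ‖u‖) := by
  have h1 := (abs_real_inner_le_norm m (contr a • a.fst)).trans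
    (mul_le_of_le_one_right (norm_nonneg _) (norm_contr_smul_fst_le a))
  have h2 := (abs_real_inner_le_norm u (contr a • a.snd)).trans
    (mul_le_of_le_one_right (norm_nonneg _) (norm_contr_smul_snd_le a))
  rw [← mul_add, abs_mul, abs_of_pos hβ]
  gcongr
  exact (abs_add_le _ _).trans (add_le_add h1 h2)

variable [FiniteDimensional ℝ E] [MeasurableSpace E] [BorelSpace E]

lemma lintegral_exp_neg_magRate_ne_top (hE : Module.finrank ℝ E = d) (hd : 0 < d) (hβ : 0 < β) :
    ∫⁻ a : WithLp 2 (E × E), ENNReal.ofReal (Real.exp (-((3 : ℕ) * magRate d β s a))) ≠ ⊤ := by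
  have hA : Module.finrank ℝ (WithLp 2 (E × E)) < 3 * d := by
    rw [(WithLp.linearEquiv 2 ℝ (E × E)).finrank_eq, Module.finrank_prod, hE]
    omega
  have hfin := isFiniteMeasure_withDensity_contr hA
  have h1 := measure_ne_top ((volume : Measure (WithLp 2 (E × E))).withDensity
    fun a => ENNReal.ofReal (contr a ^ (3 * d))) Set.univ
  rw [withDensity_apply _ MeasurableSet.univ, setLIntegral_univ] at h1
  have ht : 0 < Real.sqrt (d / β) := by positivity
  refine ne_top_of_le_ne_top (ENNReal.mul_ne_top (a := ENNReal.ofReal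
    (Real.exp (3 * d / 2) * (Real.sqrt (d / β))⁻¹ ^ (3 * d))) ENNReal.ofReal_ne_top h1) ?_
  rw [← lintegral_const_mul' _ _ ENNReal.ofReal_ne_top]
  refine lintegral_mono fun a => ?_
  rw [← ENNReal.ofReal_mul (by positivity), mul_assoc, ← mul_pow]
  refine ENNReal.ofReal_le_ofReal ?_
  set v := contr a / Real.sqrt (d / β) with hv
  have hvpos : 0 < v := div_pos (contr_pos a) ht
  rw [show (Real.sqrt (d / β))⁻¹ * contr a = v by rw [hv]; ring,
    show v ^ (3 * d) = Real.exp ((3 * d : ℕ) * Real.log v) by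
      rw [mul_comm ((3 * d : ℕ) : ℝ), Real.exp_mul, Real.exp_log hvpos, Real.rpow_natCast], ← Real.exp_add]
  refine Real.exp_le_exp.2 ?_
  rw [magRate, ← hv]
  push_cast
  have : 0 ≤ β / 2 * ‖contr a • a.snd - s‖ ^ 2 := by positivity
  have : 0 ≤ (d : ℝ) / 2 * v ^ 2 := by positivity
  linarith

lemma volume_magRate_lt_ne_zero [Nontrivial E] (hd : 0 < d) (hβ : 0 < β)
    (hs : 0 ≤ 1 - d / β - ‖s‖ ^ 2) {η : ℝ} (hη : 0 < η) :
    (volume : Measure (WithLp 2 (E × E))) {a | magRate d β s a < η} ≠ 0 := by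
  obtain ⟨a, ha⟩ := exists_magRate_eq_zero hd hβ hs
  exact ((isOpen_lt (continuous_magRate hd hβ) continuous_const).measure_pos _
    ⟨a, by simpa [ha] using hη⟩).ne'

end RateFunction

section Direction

variable {E : Type*} [NormedAddCommGroup E] [InnerProductSpace ℝ E] [FiniteDimensional ℝ E]

/-- Finitely many directions come close to every direction. -/
lemma exists_finset_directions {ε : ℝ} (hε : 0 < ε) :
    ∃ t : Finset E, (∀ u ∈ t, ‖u‖ = 1) ∧
      ∀ x : E, x ≠ 0 → ∃ u ∈ t, (1 - ε) * ‖x‖ ≤ inner ℝ u x := by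
  obtain ⟨t, hts, htf, hcov⟩ := (isCompact_sphere (0 : E) 1).finite_cover_balls
    (Real.sqrt_pos.2 (mul_pos two_pos hε))
  refine ⟨htf.toFinset, fun u hu => by simpa using hts (htf.mem_toFinset.1 hu), fun x hx => ?_⟩
  have hx' : 0 < ‖x‖ := norm_pos_iff.2 hx
  have hmem : ‖x‖⁻¹ • x ∈ Metric.sphere (0 : E) 1 := by
    simp [norm_smul, hx'.ne']
  obtain ⟨u, hu, hux⟩ := Set.mem_iUnion₂.1 (hcov hmem)
  refine ⟨u, htf.mem_toFinset.2 hu, ?_⟩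
  have hu1 : ‖u‖ = 1 := by simpa using hts hu
  have hv1 : ‖‖x‖⁻¹ • x‖ = 1 := by simpa using hmem
  rw [Metric.mem_ball, dist_eq_norm] at hux
  have h1 : ‖‖x‖⁻¹ • x - u‖ ^ 2 < 2 * ε := by
    rw [← Real.sq_sqrt (mul_pos two_pos hε).le]
    gcongr
  rw [norm_sub_sq_real, hu1, hv1, inner_smul_left, real_inner_comm] at h1
  simp only [conj_trivial] at h1
  have h2 : 1 - ε ≤ ‖x‖⁻¹ * inner ℝ u x := by linarith
  calc (1 - ε) * ‖x‖ ≤ ‖x‖⁻¹ * inner ℝ u x * ‖x‖ := by gcongr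
    _ = inner ℝ u x := by field_simp

variable [MeasurableSpace E] [BorelSpace E]

lemma gibbsWeight_misaligned_le {N n : ℕ} {β : ℝ} (hβ : 0 ≤ β) {m t : E} (hm : m ≠ 0) {ε ρ : ℝ}
    (hε : 0 ≤ ε) (hρ : 0 < ρ) {T : Finset E} (hT : ∀ u ∈ T, ‖u‖ = 1)
    (hcov : ∀ x : E, x ≠ 0 → ∃ u ∈ T, (1 - ε) * ‖x‖ ≤ inner ℝ u x) :
    gibbsWeight (WithLp 2 (E × E)) N (fieldExponent n β m t)
      {a | ρ ≤ ‖contr a • a.fst‖ ∧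
        inner ℝ (‖m‖⁻¹ • m) (contr a • a.fst) ≤ (1 - 2 * ε) * ‖contr a • a.fst‖} ≤
      T.card * (ENNReal.ofReal (Real.exp (-(n * ‖m‖ * (β * ε * ρ)))) *
        gibbsWeight (WithLp 2 (E × E)) N (fieldExponent n β m t) Set.univ) := by
  have hm' : 0 < ‖m‖ := norm_pos_iff.2 hm
  have hmu : ‖‖m‖⁻¹ • m‖ = 1 := by simp [norm_smul, hm'.ne']
  have hc1 : Continuous fun a : WithLp 2 (E × E) => a.fst := WithLp.continuous_fst ..
  let S : E → Set (WithLp 2 (E × E)) := fun u => {a | ρ ≤ ‖contr a • a.fst‖ ∧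
    inner ℝ (‖m‖⁻¹ • m) (contr a • a.fst) ≤ (1 - 2 * ε) * ‖contr a • a.fst‖ ∧
      (1 - ε) * ‖contr a • a.fst‖ ≤ inner ℝ u (contr a • a.fst)}
  have hX : Continuous fun a : WithLp 2 (E × E) => contr a • a.fst := continuous_contr.smul hc1
  have hS : ∀ u, MeasurableSet (S u) := fun u =>
    ((isClosed_le continuous_const hX.norm).inter ((isClosed_le (continuous_const.inner hX)
      (continuous_const.mul hX.norm)).inter (isClosed_le (continuous_const.mul hX.norm)
      (continuous_const.inner hX)))).measurableSet
  have hsub : {a : WithLp 2 (E × E) | ρ ≤ ‖contr a • a.fst‖ ∧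
        inner ℝ (‖m‖⁻¹ • m) (contr a • a.fst) ≤ (1 - 2 * ε) * ‖contr a • a.fst‖} ⊆
      ⋃ u ∈ T, S u := by
    rintro a ⟨h1, h2⟩
    obtain ⟨u, hu, h3⟩ := hcov (contr a • a.fst) (norm_pos_iff.1 (hρ.trans_le h1))
    exact Set.mem_iUnion₂.2 ⟨u, hu, h1, h2, h3⟩
  refine (measure_mono hsub).trans ((measure_biUnion_finset_le _ _).trans ?_)
  rw [← nsmul_eq_mul]
  refine Finset.sum_le_card_nsmul _ _ _ fun u hu => ?_
  obtain ⟨R, hR⟩ := exists_linearIsometryEquiv_apply_eq ((hT u hu).trans hmu.symm)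
  let L : WithLp 2 (E × E) ≃ₗᵢ[ℝ] WithLp 2 (E × E) :=
    LinearIsometryEquiv.withLpProdCongr 2 R (LinearIsometryEquiv.refl ℝ E)
  have hLc : ∀ a, contr (L a) = contr a := fun a => by rw [contr, contr, L.norm_map]
  have hL1 : ∀ a, (L a).fst = R a.fst := fun a => rfl
  have hL2 : ∀ a, (L a).snd = a.snd := fun a => rfl
  have hw : Measurable fun a : WithLp 2 (E × E) =>
      ENNReal.ofReal (contr a ^ N * Real.exp (fieldExponent n β m t a)) := by fun_prop
  rw [gibbsWeight, withDensity_apply _ (hS u), withDensity_apply _ MeasurableSet.univ,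
    setLIntegral_univ, ← L.measurePreserving.lintegral_comp hw,
    ← lintegral_const_mul' _ _ ENNReal.ofReal_ne_top]
  refine (setLIntegral_mono' (hS u) fun a ha => ?_).trans (setLIntegral_le_lintegral _ _)
  obtain ⟨h1, h2, h3⟩ := ha
  rw [← ENNReal.ofReal_mul (by positivity), hLc, mul_left_comm, ← Real.exp_add]
  have hcp := (contr_pos a).le
  gcongr
  have hdiff : fieldExponent n β m t (L a) - fieldExponent n β m t a =
      n * ‖m‖ * (β * (inner ℝ u (contr a • a.fst) -
        inner ℝ (‖m‖⁻¹ • m) (contr a • a.fst))) := by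
    have h4 : inner ℝ m (contr a • R a.fst) = ‖m‖ * inner ℝ u (contr a • a.fst) := by
      rw [← R.inner_map_map u, hR, map_smul, inner_smul_left]
      simp only [conj_trivial]
      field_simp
    rw [fieldExponent, fieldExponent, hLc, hL1, hL2, h4, inner_smul_left, norm_smul, R.norm_map,
      ← norm_smul]
    simp only [conj_trivial]
    field_simp
    ring
  have h5 : ε * ρ ≤ inner ℝ u (contr a • a.fst) - inner ℝ (‖m‖⁻¹ • m) (contr a • a.fst) := by
    nlinarith
  have h6 : n * ‖m‖ * (β * (ε * ρ)) ≤ n * ‖m‖ * (β * (inner ℝ u (contr a • a.fst) -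
        inner ℝ (‖m‖⁻¹ • m) (contr a • a.fst))) := by gcongr
  linarith

end Direction

section MagConcentration

variable {E : Type*} [NormedAddCommGroup E] [InnerProductSpace ℝ E]

/-- The deviation of the low-dimensional variables from their limiting values. -/
noncomputable def magDev (d : ℕ) (β : ℝ) (s m : E) (a : WithLp 2 (E × E)) : ℝ :=
  ‖contr a • a.fst - Real.sqrt (1 - d / β - ‖s‖ ^ 2) • ‖m‖⁻¹ • m‖ + ‖contr a • a.snd - s‖ +
    |contr a - Real.sqrt (d / β)|

variable {d : ℕ} {β : ℝ} {s : E}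

lemma magDev_nonneg (m : E) (a : WithLp 2 (E × E)) : 0 ≤ magDev d β s m a := by
  unfold magDev
  positivity

@[fun_prop]
lemma continuous_magDev (m : E) : Continuous (magDev d β s m) := by
  have h1 : Continuous fun a : WithLp 2 (E × E) => a.fst := WithLp.continuous_fst ..
  have h2 : Continuous fun a : WithLp 2 (E × E) => a.snd := WithLp.continuous_snd ..
  unfold magDev
  fun_prop

lemma magDev_le (m : E) (a : WithLp 2 (E × E)) :
    magDev d β s m a ≤ 3 + Real.sqrt (1 - d / β - ‖s‖ ^ 2) + ‖s‖ + Real.sqrt (d / β) := by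
  have h1 := norm_sub_le (contr a • a.fst) (Real.sqrt (1 - d / β - ‖s‖ ^ 2) • ‖m‖⁻¹ • m)
  have h2 : ‖Real.sqrt (1 - d / β - ‖s‖ ^ 2) • ‖m‖⁻¹ • m‖ ≤ Real.sqrt (1 - d / β - ‖s‖ ^ 2) := by
    rw [norm_smul, norm_smul, norm_inv, norm_norm, Real.norm_of_nonneg (Real.sqrt_nonneg _)]
    exact mul_le_of_le_one_right (Real.sqrt_nonneg _) (inv_mul_le_one)
  have h3 := norm_sub_le (contr a • a.snd) s
  have h4 : |contr a - Real.sqrt (d / β)| ≤ 1 + Real.sqrt (d / β) := by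
    rw [abs_le]
    constructor <;> linarith [contr_pos a, contr_le_one a, Real.sqrt_nonneg (d / β)]
  unfold magDev
  linarith [norm_contr_smul_fst_le a, norm_contr_smul_snd_le a]

lemma magDev_lt (hd : 0 < d) (hβ : 0 < β) (hs : 0 < 1 - d / β - ‖s‖ ^ 2) {m : E} (hm : m ≠ 0)
    {a : WithLp 2 (E × E)} {δ κ : ℝ} (hδ : 0 < δ) (hκ : 0 < κ) (h1 : κ ≤ δ / 4)
    (h2 : κ ≤ δ ^ 2 / 64) (h3 : κ ≤ 3 * (1 - d / β - ‖s‖ ^ 2) / 16)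
    (hD : magRate d β s a < β / 2 * κ ^ 2)
    (ha : ¬(Real.sqrt (1 - d / β - ‖s‖ ^ 2) / 2 ≤ ‖contr a • a.fst‖ ∧
        inner ℝ (‖m‖⁻¹ • m) (contr a • a.fst) ≤ (1 - 2 * (δ ^ 2 / 64)) * ‖contr a • a.fst‖)) :
    magDev d β s m a < δ := by
  have hm' : 0 < ‖m‖ := norm_pos_iff.2 hm
  have hmu : ‖‖m‖⁻¹ • m‖ = 1 := by simp [norm_smul, hm'.ne']
  have hr : 0 < Real.sqrt (1 - d / β - ‖s‖ ^ 2) := Real.sqrt_pos.2 hs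
  have hr2 : Real.sqrt (1 - d / β - ‖s‖ ^ 2) ^ 2 = 1 - d / β - ‖s‖ ^ 2 := Real.sq_sqrt hs.le
  have ht : 0 < Real.sqrt (d / β) := by positivity
  have ht2 : Real.sqrt (d / β) ^ 2 = d / β := Real.sq_sqrt (by positivity)
  have hlow := lt_of_mul_lt_mul_left ((le_magRate (s := s) hd hβ a).trans_lt hD) (by positivity)
  have hc := contr_sq_eq a
  have hX1 := norm_contr_smul_fst_le a
  have hY1 := norm_contr_smul_snd_le a
  have hτ1 := contr_le_one a
  have hτ0 := contr_pos a
  unfold magDev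
  set r := Real.sqrt (1 - d / β - ‖s‖ ^ 2)
  set t := Real.sqrt (d / β)
  set X := contr a • a.fst
  set Y := contr a • a.snd
  have hY : ‖Y - s‖ < κ := by
    rw [← sq_lt_sq₀ (norm_nonneg _) hκ.le]
    linarith [sq_nonneg (contr a - t)]
  have hτ : |contr a - t| < κ := by
    rw [← sq_lt_sq₀ (abs_nonneg _) hκ.le, sq_abs]
    linarith [sq_nonneg ‖Y - s‖]
  have hdβ : 0 < d / β := by positivity
  have ht1 : t ≤ 1 := (sq_le_one_iff₀ ht.le).1 (by linarith [sq_nonneg ‖s‖])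
  have hs1 : ‖s‖ ≤ 1 := (sq_le_one_iff₀ (norm_nonneg s)).1 (by linarith)
  have hYs : |‖Y‖ - ‖s‖| < κ := (abs_norm_sub_norm_le Y s).trans_lt hY
  have hr1 : r ≤ 1 := (sq_le_one_iff₀ hr.le).1 (by linarith [sq_nonneg ‖s‖])
  have hXr : |‖X‖ ^ 2 - r ^ 2| ≤ 4 * κ := by
    have e : ‖X‖ ^ 2 - r ^ 2 = -((contr a - t) * (contr a + t)) -
        (‖Y‖ - ‖s‖) * (‖Y‖ + ‖s‖) := by
      linear_combination hc - hr2 - ht2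
    have e1 : |(contr a - t) * (contr a + t)| ≤ κ * 2 := by
      rw [abs_mul]
      refine mul_le_mul hτ.le ?_ (abs_nonneg _) hκ.le
      rw [abs_of_pos (by positivity)]
      linarith
    have e2 : |(‖Y‖ - ‖s‖) * (‖Y‖ + ‖s‖)| ≤ κ * 2 := by
      rw [abs_mul]
      refine mul_le_mul hYs.le ?_ (abs_nonneg _) hκ.le
      rw [abs_of_nonneg (by positivity)]
      linarith
    rw [abs_le] at e1 e2 ⊢
    constructor <;> linarith
  have hXnn := norm_nonneg X
  have hXhalf : r / 2 ≤ ‖X‖ := by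
    by_contra! hcon
    have h4 := pow_lt_pow_left₀ hcon hXnn two_ne_zero
    linarith [(abs_le.1 hXr).1]
  have hal : (1 - 2 * (δ ^ 2 / 64)) * ‖X‖ < inner ℝ (‖m‖⁻¹ • m) X := by
    by_contra hcon
    exact ha ⟨hXhalf, not_lt.1 hcon⟩
  have hsq : (‖X‖ - r) ^ 2 ≤ 4 * κ := by
    refine le_trans ?_ hXr
    rw [show ‖X‖ ^ 2 - r ^ 2 = (‖X‖ - r) * (‖X‖ + r) by ring, abs_mul,
      abs_of_nonneg (by positivity : 0 ≤ ‖X‖ + r), ← sq_abs, pow_two]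
    refine mul_le_mul_of_nonneg_left ?_ (abs_nonneg _)
    rw [abs_le]
    constructor <;> linarith
  have hX : ‖X - r • ‖m‖⁻¹ • m‖ ≤ δ / 2 := by
    rw [← sq_le_sq₀ (norm_nonneg _) (by positivity), norm_sub_sq_real, norm_smul r, hmu,
      Real.norm_of_nonneg hr.le, inner_smul_right, real_inner_comm]
    have h5 : r * ((1 - 2 * (δ ^ 2 / 64)) * ‖X‖) ≤ r * inner ℝ (‖m‖⁻¹ • m) X := by gcongr
    have h6 : r * ‖X‖ ≤ 1 := mul_le_one₀ hr1 hXnn hX1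
    have h7 : δ ^ 2 * (r * ‖X‖) ≤ δ ^ 2 * 1 := by gcongr
    linarith
  linarith

variable [FiniteDimensional ℝ E] [MeasurableSpace E] [BorelSpace E]

lemma gibbsWeight_eq_withDensity_magRate (hd : 0 < d) (hβ : 0 < β) (n : ℕ) (m t : E) :
    gibbsWeight (WithLp 2 (E × E)) (n * d) (fieldExponent n β m t) =
      volume.withDensity fun a => ENNReal.ofReal
        (Real.exp (n * (β / 2 * (1 + ‖s‖ ^ 2) - d / 2 + d * Real.log (Real.sqrt (d / β)))) *
        Real.exp (n * ((β * inner ℝ m (contr a • a.fst) +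
          β * inner ℝ (t - s) (contr a • a.snd)) - magRate d β s a))) := by
  rw [gibbsWeight]
  congr 2 with a
  rw [contr_pow_mul_exp_fieldExponent hd hβ]

lemma gibbsWeight_univ_ne_zero_and_ne_top [Nontrivial E] (hE : Module.finrank ℝ E = d) (hd : 0 < d)
    (hβ : 0 < β) (hs : 0 < 1 - d / β - ‖s‖ ^ 2) {n : ℕ} (hn : 3 ≤ n) (m t : E) :
    gibbsWeight (WithLp 2 (E × E)) (n * d) (fieldExponent n β m t) Set.univ ≠ 0 ∧
      gibbsWeight (WithLp 2 (E × E)) (n * d) (fieldExponent n β m t) Set.univ ≠ ⊤ := by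
  rw [gibbsWeight_eq_withDensity_magRate (s := s) hd hβ]
  have hD := (continuous_magRate (s := s) hd hβ).measurable
  exact ⟨withDensity_exp_univ_ne_zero hD (fun η hη => volume_magRate_lt_ne_zero hd hβ hs.le hη)
    (Real.exp_pos _) fun a => abs_field_error_le hβ m (t - s) a,
    withDensity_exp_univ_ne_top hD (magRate_nonneg hd hβ) hn
      (lintegral_exp_neg_magRate_ne_top hE hd hβ) (Real.exp_pos _)
      fun a => abs_field_error_le hβ m (t - s) a⟩

lemma tendsto_integral_magDev [Nontrivial E] (hE : Module.finrank ℝ E = d) (hd : 0 < d)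
    (hβ : 0 < β) (hs : 0 < 1 - d / β - ‖s‖ ^ 2) {m t : ℕ → E} (hm : Tendsto m atTop (𝓝 0))
    (ht : Tendsto t atTop (𝓝 s)) (hnm : Tendsto (fun n : ℕ => n * ‖m n‖) atTop atTop) :
    Tendsto (fun n : ℕ => ∫ a, magDev d β s (m n) a
      ∂(nrm (gibbsWeight (WithLp 2 (E × E)) (n * d) (fieldExponent n β (m n) (t n)))))
      atTop (𝓝 0) := by
  refine tendsto_integral_of_tendsto_measure
    (P := fun n => nrm (gibbsWeight (WithLp 2 (E × E)) (n * d) (fieldExponent n β (m n) (t n))))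
    ?_ (fun n => (continuous_magDev (m n)).measurable) (fun n => magDev_nonneg (m n))
    (fun n => magDev_le (m n)) fun δ hδ => ?_
  · filter_upwards [eventually_ge_atTop 3] with n hn
    have := gibbsWeight_univ_ne_zero_and_ne_top hE hd hβ hs hn (m n) (t n)
    exact isProbabilityMeasure_nrm this.1 this.2
  obtain ⟨κ, hκ, h1, h2, h3⟩ : ∃ κ > 0, κ ≤ δ / 4 ∧ κ ≤ δ ^ 2 / 64 ∧
      κ ≤ 3 * (1 - d / β - ‖s‖ ^ 2) / 16 :=
    ⟨min (δ / 4) (min (δ ^ 2 / 64) (3 * (1 - d / β - ‖s‖ ^ 2) / 16)), by positivity,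
      min_le_left _ _, (min_le_right _ _).trans (min_le_left _ _),
      (min_le_right _ _).trans (min_le_right _ _)⟩
  have hε : 0 < δ ^ 2 / 64 := by positivity
  obtain ⟨T, hT, hcov⟩ := exists_finset_directions (E := E) hε
  have hρ : 0 < Real.sqrt (1 - d / β - ‖s‖ ^ 2) / 2 := by
    have := Real.sqrt_pos.2 hs
    positivity
  have hlim1 : Tendsto (fun n : ℕ => nrm (gibbsWeight (WithLp 2 (E × E)) (n * d)
      (fieldExponent n β (m n) (t n))) {a | β / 2 * κ ^ 2 ≤ magRate d β s a}) atTop (𝓝 0) := by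
    simp only [gibbsWeight_eq_withDensity_magRate (s := s) hd hβ]
    refine tendsto_nrm_withDensity_exp_superlevel (continuous_magRate hd hβ).measurable
      (lintegral_exp_neg_magRate_ne_top hE hd hβ)
      (fun η hη => volume_magRate_lt_ne_zero hd hβ hs.le hη)
      (c := fun n : ℕ => Real.exp (n * (β / 2 * (1 + ‖s‖ ^ 2) - d / 2 +
        d * Real.log (Real.sqrt (d / β)))))
      (δ := fun n => β * (‖m n‖ + ‖t n - s‖)) (fun n => Real.exp_pos _)
      (e := fun n a => β * inner ℝ (m n) (contr a • a.fst) +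
          β * inner ℝ (t n - s) (contr a • a.snd))
      (fun n a => abs_field_error_le hβ (m n) (t n - s) a) ?_ (by positivity)
    have := (hm.norm.add (ht.sub_const s).norm).const_mul β
    simpa using this
  have hlim2 : Tendsto (fun n : ℕ => (T.card : ENNReal) * ENNReal.ofReal (Real.exp
      (-(n * ‖m n‖ * (β * (δ ^ 2 / 64) * (Real.sqrt (1 - d / β - ‖s‖ ^ 2) / 2)))))) atTop
      (𝓝 0) := by
    have h4 : Tendsto (fun n : ℕ => Real.exp
        (-(n * ‖m n‖ * (β * (δ ^ 2 / 64) * (Real.sqrt (1 - d / β - ‖s‖ ^ 2) / 2))))) atTop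
        (𝓝 0) :=
      Real.tendsto_exp_neg_atTop_nhds_zero.comp (hnm.atTop_mul_const (by positivity))
    have h5 := ENNReal.Tendsto.const_mul (a := (T.card : ENNReal)) (ENNReal.tendsto_ofReal h4)
      (Or.inr (ENNReal.natCast_ne_top _))
    simpa using h5
  have hlim := hlim1.add hlim2
  rw [add_zero] at hlim
  refine tendsto_of_tendsto_of_tendsto_of_le_of_le' tendsto_const_nhds hlim
    (Eventually.of_forall fun n => zero_le) ?_
  filter_upwards [eventually_ge_atTop 3, hnm.eventually_gt_atTop 0] with n hn hpos
  have hm0 : m n ≠ 0 := by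
    rintro h
    simp [h] at hpos
  obtain ⟨hQ0, hQt⟩ := gibbsWeight_univ_ne_zero_and_ne_top hE hd hβ hs hn (m n) (t n)
  have hmis := gibbsWeight_misaligned_le (N := n * d) (n := n) (t := t n) hβ.le hm0 hε.le hρ hT hcov
  set Q := gibbsWeight (WithLp 2 (E × E)) (n * d) (fieldExponent n β (m n) (t n))
  have hsub : {a | δ ≤ magDev d β s (m n) a} ⊆ {a | β / 2 * κ ^ 2 ≤ magRate d β s a} ∪
      {a | Real.sqrt (1 - d / β - ‖s‖ ^ 2) / 2 ≤ ‖contr a • a.fst‖ ∧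
        inner ℝ (‖m n‖⁻¹ • m n) (contr a • a.fst) ≤
          (1 - 2 * (δ ^ 2 / 64)) * ‖contr a • a.fst‖} := by
    intro a ha
    by_contra hcon
    rw [Set.mem_union, not_or] at hcon
    exact absurd ha (not_le.2 (magDev_lt hd hβ hs hm0 hδ hκ h1 h2 h3 (not_le.1 hcon.1) hcon.2))
  refine (measure_mono hsub).trans ((measure_union_le _ _).trans (add_le_add le_rfl ?_))
  rw [nrm, Measure.smul_apply, smul_eq_mul]
  refine (mul_le_mul' le_rfl hmis).trans (le_of_eq ?_)
  rw [← mul_assoc (T.card : ENNReal), mul_comm, mul_assoc, ENNReal.mul_inv_cancel hQ0 hQt, mul_one]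

end MagConcentration

section Splitting

variable {A V W : Type*} [NormedAddCommGroup A] [InnerProductSpace ℝ A] [NormedAddCommGroup V]
  [InnerProductSpace ℝ V] [NormedAddCommGroup W] [InnerProductSpace ℝ W]

lemma inner_apply_snd_symm (I : WithLp 2 (A × W) ≃ₗᵢ[ℝ] V) (u g : V) :
    inner ℝ u (I (WithLp.toLp 2 (0, (I.symm g).snd))) =
      inner ℝ (I (WithLp.toLp 2 (0, (I.symm u).snd))) g := by
  have h1 := I.inner_map_map (I.symm u) (WithLp.toLp 2 (0, (I.symm g).snd))
  have h2 := I.inner_map_map (WithLp.toLp 2 (0, (I.symm u).snd)) (I.symm g)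
  rw [I.apply_symm_apply] at h1 h2
  rw [h1, h2]
  simp [WithLp.prod_inner_apply]

lemma sub_inner_apply_snd_symm (I : WithLp 2 (A × W) ≃ₗᵢ[ℝ] V) (u g : V) :
    inner ℝ u g - inner ℝ u (I (WithLp.toLp 2 (0, (I.symm g).snd))) =
      inner ℝ (I (WithLp.toLp 2 ((I.symm u).fst, 0))) g := by
  have h : I (WithLp.toLp 2 ((I.symm u).fst, 0)) + I (WithLp.toLp 2 (0, (I.symm u).snd)) = u := by
    rw [← map_add, ← WithLp.toLp_add]
    simp only [Prod.mk_add_mk, add_zero, zero_add]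
    exact I.apply_symm_apply u
  rw [inner_apply_snd_symm, sub_eq_iff_eq_add, ← inner_add_left, h]

end Splitting

section StdGaussian

open ProbabilityTheory

variable {V W : Type*} [NormedAddCommGroup V] [InnerProductSpace ℝ V] [FiniteDimensional ℝ V]
  [MeasurableSpace V] [BorelSpace V] [NormedAddCommGroup W] [InnerProductSpace ℝ W]
  [FiniteDimensional ℝ W] [MeasurableSpace W] [BorelSpace W]

lemma integrable_inner_sq_stdGaussian (u : V) :
    Integrable (fun x => (inner ℝ u x) ^ 2) (stdGaussian V) :=
  ((IsGaussian.memLp_dual (stdGaussian V) (innerSL ℝ u) 2 (by simp)).integrable_sq)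

lemma integral_inner_sq_stdGaussian (u : V) :
    ∫ x, (inner ℝ u x) ^ 2 ∂(stdGaussian V) = ‖u‖ ^ 2 := by
  have h := variance_dual_stdGaussian (innerSL ℝ u : StrongDual ℝ V)
  rw [variance_eq_integral (by fun_prop), integral_strongDual_stdGaussian, innerSL_apply_norm] at h
  simpa using h

lemma memLp_sq_gaussianReal : MemLp (fun x : ℝ => x ^ 2) 2 (gaussianReal 0 1) := by
  have h : MemLp (fun x : ℝ => x) 4 (gaussianReal 0 1) := memLp_id_gaussianReal 4
  have := (memLp_two_iff_integrable_sq (μ := gaussianReal 0 1) (f := fun x : ℝ => x ^ 2)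
    (by fun_prop)).2
  refine this ?_
  have h2 := h.integrable_norm_pow (p := 4) (by norm_num)
  refine h2.congr (ae_of_all _ fun x => ?_)
  simp only [Real.norm_eq_abs]
  rw [← pow_mul, Even.pow_abs (by decide)]

lemma integral_sq_gaussianReal : ∫ x, x ^ 2 ∂(gaussianReal 0 1) = 1 := by
  have h := variance_fun_id_gaussianReal (μ := 0) (v := 1)
  rw [variance_eq_integral (by fun_prop)] at h
  simpa using h

lemma integrable_and_integral_norm_sq_stdGaussian (M : ℕ) :
    Integrable (fun x : EuclideanSpace ℝ (Fin M) => (‖x‖ ^ 2 - M) ^ 2)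
        (stdGaussian (EuclideanSpace ℝ (Fin M))) ∧
      ∫ x : EuclideanSpace ℝ (Fin M), (‖x‖ ^ 2 - M) ^ 2 ∂(stdGaussian _) =
        M * Var[fun x : ℝ => x ^ 2; gaussianReal 0 1] := by
  have hmem : ∀ i : Fin M, MemLp (fun x : Fin M → ℝ => x i ^ 2) 2
      (Measure.pi fun _ => gaussianReal 0 1) := fun i =>
    memLp_sq_gaussianReal.comp_measurePreserving
      (measurePreserving_eval (fun _ : Fin M => gaussianReal 0 1) i)
  have hsum : MemLp (fun x : Fin M → ℝ => ∑ i, x i ^ 2) 2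
      (Measure.pi fun _ => gaussianReal 0 1) := memLp_finsetSum _ fun i _ => hmem i
  have hmean : ∫ x : Fin M → ℝ, ∑ i, x i ^ 2 ∂(Measure.pi fun _ => gaussianReal 0 1) = M := by
    rw [integral_finsetSum _ fun i _ => (hmem i).integrable (by norm_num)]
    have : ∀ i : Fin M, ∫ x : Fin M → ℝ, x i ^ 2 ∂(Measure.pi fun _ => gaussianReal 0 1) = 1 := by
      intro i
      have hi := measurePreserving_eval (fun _ : Fin M => gaussianReal 0 1) i
      rw [← integral_sq_gaussianReal]
      conv_rhs => rw [← hi.map_eq, integral_map hi.measurable.aemeasurable (by fun_prop)]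
    simp [this]
  have hvar := variance_sum_pi (μ := fun _ : Fin M => gaussianReal 0 1)
    (X := fun _ x => x ^ 2) fun _ => memLp_sq_gaussianReal
  have hnorm : ∀ x : Fin M → ℝ, ‖WithLp.toLp 2 x‖ ^ 2 = ∑ i, x i ^ 2 := fun x => by
    simp [EuclideanSpace.norm_sq_eq]
  rw [← map_pi_eq_stdGaussian]
  constructor
  · rw [integrable_map_measure (by fun_prop) (by fun_prop)]
    simp only [Function.comp_def, hnorm]
    exact (hsum.sub (memLp_const _)).integrable_sq
  · rw [integral_map (by fun_prop) (by fun_prop)]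
    simp only [hnorm]
    have hfun : (∑ i : Fin M, fun x : Fin M → ℝ => x i ^ 2) = fun x => ∑ i, x i ^ 2 := by
      ext x
      simp
    rw [hfun, variance_eq_integral hsum.aemeasurable, hmean] at hvar
    simpa using hvar

variable {A : Type*} [NormedAddCommGroup A] [InnerProductSpace ℝ A]

lemma stdGaussian_map_snd_symm (I : WithLp 2 (A × W) ≃ₗᵢ[ℝ] V) :
    (stdGaussian V).map (fun g => (I.symm g).snd) = stdGaussian W := by
  have hc : Continuous fun g => (I.symm g).snd := (WithLp.continuous_snd ..).comp I.symm.continuous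
  have : IsFiniteMeasure ((stdGaussian V).map fun g => (I.symm g).snd) := inferInstance
  refine Measure.ext_of_charFun (E := W) ?_
  ext t
  have h := charFun_stdGaussian (I (WithLp.toLp 2 (0, t)))
  rw [charFun_apply, I.norm_map] at h
  rw [charFun_stdGaussian, charFun_apply, integral_map hc.measurable.aemeasurable (by fun_prop)]
  convert h using 4 with g
  · have := I.inner_map_map (I.symm g) (WithLp.toLp 2 (0, t))
    rw [I.apply_symm_apply] at this
    rw [this]
    simp [WithLp.prod_inner_apply]
  · simp

end StdGaussian

section Coupling

lemma sqrt_sub_sq_le {d n M : ℕ} (hd : 1 ≤ d) (hn : 1 ≤ n) (hM : M + 2 * d = n * d) {x : ℝ}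
    (hx : 0 ≤ x) :
    (Real.sqrt d - x / Real.sqrt n) ^ 2 ≤ 2 * ((x ^ 2 - M) ^ 2 + 4 * d ^ 2) / n ^ 2 := by
  have hd' : (1 : ℝ) ≤ d := by exact_mod_cast hd
  have hn' : (0 : ℝ) < n := by exact_mod_cast hn
  have hM' : (M : ℝ) + 2 * d = n * d := by exact_mod_cast hM
  have h1 : 1 ≤ Real.sqrt d := Real.one_le_sqrt.2 hd'
  have h2 : Real.sqrt d ^ 2 = d := Real.sq_sqrt (by positivity)
  have h3 : Real.sqrt n ^ 2 = n := Real.sq_sqrt hn'.le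
  have hρ : 0 ≤ x / Real.sqrt n := by positivity
  have hρ2 : (x / Real.sqrt n) ^ 2 = x ^ 2 / n := by rw [div_pow, h3]
  set ρ := x / Real.sqrt n
  calc (Real.sqrt d - ρ) ^ 2 ≤ (Real.sqrt d - ρ) ^ 2 * (Real.sqrt d + ρ) ^ 2 :=
        le_mul_of_one_le_right (sq_nonneg _) (one_le_pow₀ (by linarith))
    _ = (d - x ^ 2 / n) ^ 2 := by rw [← hρ2]; nth_rewrite 3 [← h2]; ring
    _ = ((M - x ^ 2) + 2 * d) ^ 2 / n ^ 2 := by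
        rw [← div_pow]; congr 1; field_simp; linarith
    _ ≤ 2 * ((x ^ 2 - M) ^ 2 + 4 * d ^ 2) / n ^ 2 := by
        gcongr
        nlinarith [sq_nonneg ((M - x ^ 2) - 2 * d)]

lemma abs_div_sub_div_le {q ρ τ t δ : ℝ} (hq : 1 ≤ q) (ht0 : 0 ≤ t) (ht1 : t ≤ 1)
    (hρ : q / 2 ≤ ρ) (hδ : |τ - t| ≤ δ) :
    |τ / ρ - t / q| ≤ 2 * δ + 2 * |q - ρ| := by
  have hq0 : 0 < q := by linarith
  have hρ0 : 0 < ρ := by linarith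
  have h1 : τ / ρ - t / q = ((τ - t) * q + t * (q - ρ)) / (ρ * q) := by
    field_simp
    ring
  have h2 : |(τ - t) * q + t * (q - ρ)| ≤ δ * q + |q - ρ| := by
    refine (abs_add_le _ _).trans ?_
    rw [abs_mul, abs_mul, abs_of_pos hq0, abs_of_nonneg ht0]
    exact add_le_add (by gcongr) (mul_le_of_le_one_left (abs_nonneg _) ht1)
  have hδ0 : 0 ≤ δ := (abs_nonneg _).trans hδ
  rw [h1, abs_div, abs_of_pos (by positivity : 0 < ρ * q), div_le_iff₀ (by positivity)]
  refine h2.trans ?_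
  have h3 : 1 ≤ 2 * (ρ * q) := by nlinarith
  have h4 : q ≤ 2 * (ρ * q) := by nlinarith
  have h5 := mul_le_mul_of_nonneg_left h4 hδ0
  have h6 := mul_le_mul_of_nonneg_left h3 (abs_nonneg (q - ρ))
  linarith

lemma min_abs_coupling_le {q ρ τ t δ δ₀ e₀ K X l : ℝ} (hq : 1 ≤ q) (ht0 : 0 ≤ t) (ht1 : t ≤ 1)
    (hδ : |τ - t| ≤ δ) (he : |e₀| ≤ δ₀) (hl : 1 ≤ l) :
    min |e₀ + τ / ρ * K - t / q * X| 1 ≤ δ₀ + δ * (1 + K ^ 2) + (K ^ 2 + 1) / l +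
      5 * l * (q - ρ) ^ 2 + l * (X - K) ^ 2 := by
  have hδ0 : 0 ≤ δ := (abs_nonneg _).trans hδ
  have he0 : 0 ≤ δ₀ := (abs_nonneg _).trans he
  have hl0 : 0 < l := by linarith
  have young : ∀ x y : ℝ, 2 * (|x| * |y|) ≤ l * x ^ 2 + y ^ 2 / l := fun x y => by
    rw [← sq_abs x, ← sq_abs y, ← sub_nonneg]
    have : l * |x| ^ 2 + |y| ^ 2 / l - 2 * (|x| * |y|) = (l * |x| - |y|) ^ 2 / l := by
      field_simp
      ring
    rw [this]
    positivity
  rcases le_or_gt (q / 2) ρ with h | h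
  · refine (min_le_left _ _).trans ?_
    have h1 : e₀ + τ / ρ * K - t / q * X = e₀ + (τ / ρ - t / q) * K - t / q * (X - K) := by ring
    have h2 : |(τ / ρ - t / q) * K| ≤ δ * (1 + K ^ 2) + (l * (q - ρ) ^ 2 + K ^ 2 / l) := by
      rw [abs_mul]
      have h3 := mul_le_mul_of_nonneg_right (abs_div_sub_div_le hq ht0 ht1 h hδ) (abs_nonneg K)
      have h4 : 2 * |K| ≤ 1 + K ^ 2 := by nlinarith [sq_nonneg (|K| - 1), sq_abs K]
      have h5 := mul_le_mul_of_nonneg_left h4 hδ0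
      linarith [young (q - ρ) K]
    have h6 : |t / q * (X - K)| ≤ l * (X - K) ^ 2 + 1 / l := by
      rw [abs_mul, abs_of_nonneg (by positivity)]
      have h7 : t / q ≤ 1 := (div_le_one (by linarith)).2 (by linarith)
      have h8 := young (X - K) 1
      rw [abs_one, one_pow, mul_one] at h8
      have := mul_le_of_le_one_left (abs_nonneg (X - K)) h7
      linarith [abs_nonneg (X - K)]
    rw [h1]
    have h9 := abs_sub (e₀ + (τ / ρ - t / q) * K) (t / q * (X - K))
    have h10 := abs_add_le e₀ ((τ / ρ - t / q) * K)
    have h11 : 0 ≤ l * (q - ρ) ^ 2 := by positivity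
    rw [add_div]
    linarith
  · refine (min_le_right _ _).trans ?_
    have h1 : (1 / 2) ^ 2 ≤ (q - ρ) ^ 2 := by gcongr; linarith
    have h2 : 1 ≤ 5 * l * (q - ρ) ^ 2 := by nlinarith
    have h3 : 0 ≤ δ * (1 + K ^ 2) + (K ^ 2 + 1) / l + l * (X - K) ^ 2 := by positivity
    linarith

open ProbabilityTheory

variable {A V : Type*} [NormedAddCommGroup A] [InnerProductSpace ℝ A] [NormedAddCommGroup V]
  [InnerProductSpace ℝ V] [FiniteDimensional ℝ V] [MeasurableSpace V] [BorelSpace V]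

lemma integral_min_abs_coupling_le {d n M : ℕ} (hd : 1 ≤ d) (hn : 1 ≤ n) (hM : M + 2 * d = n * d)
    (I : WithLp 2 (A × EuclideanSpace ℝ (Fin M)) ≃ₗᵢ[ℝ] V) {u : V} (hu : ‖u‖ = 1) {κ : ℝ}
    (hκ : ‖(I.symm u).fst‖ ≤ κ / Real.sqrt n) {τ t δ δ₀ e₀ : ℝ} (ht0 : 0 ≤ t) (ht1 : t ≤ 1)
    (hδ : |τ - t| ≤ δ) (he : |e₀| ≤ δ₀) :
    ∫ g, min |e₀ + τ / (‖(I.symm g).snd‖ / Real.sqrt n) *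
        inner ℝ u (I (WithLp.toLp 2 (0, (I.symm g).snd))) - t / Real.sqrt d * inner ℝ u g| 1
      ∂(stdGaussian V) ≤ δ₀ + 2 * δ +
        (2 + 10 * (d * Var[fun x : ℝ => x ^ 2; gaussianReal 0 1] + 4 * d ^ 2) + κ ^ 2) /
          Real.sqrt n := by
  have hn' : (1 : ℝ) ≤ n := by exact_mod_cast hn
  have hl : 1 ≤ Real.sqrt n := Real.one_le_sqrt.2 hn'
  have hl0 : 0 < Real.sqrt n := by linarith
  have hl2 : Real.sqrt n ^ 2 = n := Real.sq_sqrt (by linarith)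
  have hq : 1 ≤ Real.sqrt d := Real.one_le_sqrt.2 (by exact_mod_cast hd)
  have hδ0 : 0 ≤ δ := (abs_nonneg _).trans hδ
  set c := Var[fun x : ℝ => x ^ 2; gaussianReal 0 1]
  have hc : 0 ≤ c := variance_nonneg _ _
  set k := I (WithLp.toLp 2 (0, (I.symm u).snd))
  set k' := I (WithLp.toLp 2 ((I.symm u).fst, 0))
  have hk : ‖k‖ ^ 2 ≤ 1 := by
    have h1 := WithLp.prod_norm_sq_eq_of_L2 (I.symm u)
    rw [I.symm.norm_map, hu] at h1
    have h2 : ‖k‖ = ‖(I.symm u).snd‖ := by simp [k]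
    rw [h2]
    linarith [sq_nonneg ‖(I.symm u).fst‖]
  have hk' : ‖k'‖ ^ 2 ≤ κ ^ 2 / n := by
    have h2 : ‖k'‖ = ‖(I.symm u).fst‖ := by simp [k']
    rw [h2, ← hl2, ← div_pow]
    gcongr
  have hsnd : Measurable fun g => (I.symm g).snd :=
    ((WithLp.continuous_snd ..).comp I.symm.continuous).measurable
  obtain ⟨hZ1, hZ2⟩ := integrable_and_integral_norm_sq_stdGaussian M
  rw [← stdGaussian_map_snd_symm I] at hZ1 hZ2
  rw [integrable_map_measure (by fun_prop) hsnd.aemeasurable] at hZ1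
  rw [integral_map hsnd.aemeasurable (by fun_prop)] at hZ2
  change _ = M * c at hZ2
  have hK1 := integrable_inner_sq_stdGaussian k
  have hK2 := integral_inner_sq_stdGaussian k
  have hL1 := integrable_inner_sq_stdGaussian k'
  have hL2 := integral_inner_sq_stdGaussian k'
  have hZ1' : Integrable (fun g => (‖(I.symm g).snd‖ ^ 2 - M) ^ 2) (stdGaussian V) := hZ1
  let B : V → ℝ := fun g => (δ₀ + δ + 1 / Real.sqrt n + 5 * Real.sqrt n * (8 * d ^ 2 / n ^ 2)) +
    (δ + 1 / Real.sqrt n) * (inner ℝ k g) ^ 2 +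
    (5 * Real.sqrt n * 2 / n ^ 2) * (‖(I.symm g).snd‖ ^ 2 - M) ^ 2 +
    Real.sqrt n * (inner ℝ k' g) ^ 2
  have hB1 : Integrable (fun g => (δ₀ + δ + 1 / Real.sqrt n + 5 * Real.sqrt n *
      (8 * d ^ 2 / n ^ 2)) + (δ + 1 / Real.sqrt n) * (inner ℝ k g) ^ 2) (stdGaussian V) :=
    (integrable_const _).add (hK1.const_mul _)
  have hB2 : Integrable (fun g => (δ₀ + δ + 1 / Real.sqrt n + 5 * Real.sqrt n *
      (8 * d ^ 2 / n ^ 2)) + (δ + 1 / Real.sqrt n) * (inner ℝ k g) ^ 2 +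
      (5 * Real.sqrt n * 2 / n ^ 2) * (‖(I.symm g).snd‖ ^ 2 - M) ^ 2) (stdGaussian V) :=
    hB1.add (hZ1'.const_mul _)
  have hB : Integrable B (stdGaussian V) := hB2.add (hL1.const_mul _)
  have hBint : ∫ g, B g ∂(stdGaussian V) =
      (δ₀ + δ + 1 / Real.sqrt n + 5 * Real.sqrt n * (8 * d ^ 2 / n ^ 2)) +
      (δ + 1 / Real.sqrt n) * ‖k‖ ^ 2 + (5 * Real.sqrt n * 2 / n ^ 2) * (M * c) +
      Real.sqrt n * ‖k'‖ ^ 2 := by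
    simp only [B]
    rw [integral_add hB2 (hL1.const_mul _), integral_add hB1 (hZ1'.const_mul _),
      integral_add (integrable_const _) (hK1.const_mul _)]
    simp only [integral_const_mul, hK2, hL2, hZ2]
    simp
  refine (integral_mono_of_nonneg (ae_of_all _ fun g => by positivity) hB
    (ae_of_all _ fun g => ?_)).trans ?_
  · have h1 := min_abs_coupling_le (ρ := ‖(I.symm g).snd‖ / Real.sqrt n)
      (K := inner ℝ u (I (WithLp.toLp 2 (0, (I.symm g).snd)))) (X := inner ℝ u g) hq ht0 ht1 hδ he hl
    refine h1.trans ?_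
    rw [sub_inner_apply_snd_symm, inner_apply_snd_symm]
    have h2 := mul_le_mul_of_nonneg_left
      (sqrt_sub_sq_le hd hn hM (norm_nonneg (I.symm g).snd)) (by positivity : 0 ≤ 5 * Real.sqrt n)
    simp only [B]
    rw [show 5 * Real.sqrt n * (2 * ((‖(I.symm g).snd‖ ^ 2 - M) ^ 2 + 4 * d ^ 2) / n ^ 2) =
      5 * Real.sqrt n * (8 * d ^ 2 / n ^ 2) +
      (5 * Real.sqrt n * 2 / n ^ 2) * (‖(I.symm g).snd‖ ^ 2 - M) ^ 2 by ring] at h2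
    rw [show (inner ℝ k g ^ 2 + 1) / Real.sqrt n =
      1 / Real.sqrt n * inner ℝ k g ^ 2 + 1 / Real.sqrt n by ring]
    linarith
  · rw [hBint]
    have hMn : (M : ℝ) ≤ n * d := by
      have : (M : ℝ) + 2 * d = n * d := by exact_mod_cast hM
      have h0 : (0 : ℝ) ≤ d := by positivity
      linarith
    have h1 : (δ + 1 / Real.sqrt n) * ‖k‖ ^ 2 ≤ δ + 1 / Real.sqrt n :=
      mul_le_of_le_one_right (by positivity) hk
    have h2 : Real.sqrt n * ‖k'‖ ^ 2 ≤ κ ^ 2 / Real.sqrt n := by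
      refine (mul_le_mul_of_nonneg_left hk' hl0.le).trans (le_of_eq ?_)
      field_simp
      rw [hl2, mul_comm]
    have h3 : (5 * Real.sqrt n * 2 / n ^ 2) * (M * c) ≤ 10 * (d * c) / Real.sqrt n := by
      refine (mul_le_mul_of_nonneg_left (mul_le_mul_of_nonneg_right hMn hc)
        (by positivity)).trans (le_of_eq ?_)
      field_simp
      rw [hl2]
      ring
    have h4 : 5 * Real.sqrt n * (8 * d ^ 2 / n ^ 2) ≤ 10 * (4 * d ^ 2) / Real.sqrt n := by
      have h5 : 5 * Real.sqrt n * (8 * d ^ 2 / n ^ 2) = 40 * d ^ 2 / Real.sqrt n * (1 / n) := by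
        field_simp
        rw [hl2]
        ring
      rw [h5]
      refine (mul_le_of_le_one_right (by positivity) ((div_le_one (by linarith)).2 hn')).trans
        (le_of_eq (by ring))
    calc _ ≤ (δ₀ + δ + 1 / Real.sqrt n + 10 * (4 * d ^ 2) / Real.sqrt n) +
        (δ + 1 / Real.sqrt n) + 10 * (d * c) / Real.sqrt n + κ ^ 2 / Real.sqrt n := by linarith
      _ = _ := by ring

end Coupling

section Metric

variable {d : ℕ}

lemma w_pos (p : ℕ × Fin d) : 0 < w d p := by unfold w; positivity

lemma summable_w : Summable (w d) := by
  have h1 : Summable fun i : ℕ => ((1 : ℝ) / 2) ^ (i + 1) :=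
    (summable_nat_add_iff 1).2 summable_geometric_two
  have h2 : Summable fun j : Fin d => ((1 : ℝ) / 2) ^ ((j : ℕ) + 1) := Summable.of_finite
  refine (h1.mul_of_nonneg h2 (fun i => by positivity) fun j => by positivity).congr fun p => ?_
  rw [w, pow_add _ (p.1 + 1)]

lemma summable_w_mul_min (φ φ' : ℕ → Fin d → ℝ) :
    Summable fun p : ℕ × Fin d => w d p * min |φ p.1 p.2 - φ' p.1 p.2| 1 :=
  Summable.of_nonneg_of_le (fun p => mul_nonneg (w_pos p).le (by positivity))
    (fun p => mul_le_of_le_one_right (w_pos p).le (min_le_right _ _)) summable_w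

lemma Cd_nonneg : 0 ≤ Cd d := tsum_nonneg fun p => (w_pos p).le

lemma inv_Cd_mul_w_le_one (p : ℕ × Fin d) : (Cd d)⁻¹ * w d p ≤ 1 := by
  have h : w d p ≤ Cd d := summable_w.le_tsum p fun q _ => (w_pos q).le
  rw [inv_mul_le_iff₀ ((w_pos p).trans_le h)]
  linarith

/-- The total weight in the metric of the sites from `N` on. -/
noncomputable def tailWeight (d N : ℕ) : ℝ :=
  (Cd d)⁻¹ * ∑' p : ℕ × Fin d, w d p * if p.1 < N then 0 else 1

lemma summable_tailWeight (N : ℕ) :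
    Summable fun p : ℕ × Fin d => w d p * if p.1 < N then 0 else 1 := by
  refine Summable.of_nonneg_of_le (fun p => mul_nonneg (w_pos p).le ?_)
    (fun p => mul_le_of_le_one_right (w_pos p).le ?_) summable_w <;> split_ifs <;> norm_num

lemma tendsto_tailWeight : Tendsto (tailWeight d) atTop (𝓝 0) := by
  have h : Tendsto (fun N : ℕ => ∑' p : ℕ × Fin d, w d p * if p.1 < N then 0 else 1) atTop
      (𝓝 (∑' _ : ℕ × Fin d, (0 : ℝ))) := by
    refine tendsto_tsum_of_dominated_convergence summable_w (fun p => ?_)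
      (Eventually.of_forall fun N p => ?_)
    · refine tendsto_const_nhds.congr' ?_
      filter_upwards [eventually_gt_atTop p.1] with N hN
      simp [hN]
    · rw [Real.norm_of_nonneg (mul_nonneg (w_pos p).le (by split_ifs <;> norm_num))]
      exact mul_le_of_le_one_right (w_pos p).le (by split_ifs <;> norm_num)
  rw [tsum_zero] at h
  have h2 := h.const_mul (Cd d)⁻¹
  rwa [mul_zero] at h2

lemma cfgDist_le (N : ℕ) (φ φ' : ℕ → Fin d → ℝ) :
    cfgDist d φ φ' ≤ ∑ p ∈ Finset.range N ×ˢ Finset.univ, min |φ p.1 p.2 - φ' p.1 p.2| 1 +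
      tailWeight d N := by
  have hle : ∀ p : ℕ × Fin d, w d p * min |φ p.1 p.2 - φ' p.1 p.2| 1 ≤
      (if p.1 < N then w d p * min |φ p.1 p.2 - φ' p.1 p.2| 1 else 0) +
        w d p * if p.1 < N then 0 else 1 := fun p => by
    split_ifs
    · simp
    · simpa using mul_le_of_le_one_right (w_pos p).le (min_le_right _ _)
  have hfin : ∀ p ∉ Finset.range N ×ˢ (Finset.univ : Finset (Fin d)),
      (if p.1 < N then w d p * min |φ p.1 p.2 - φ' p.1 p.2| 1 else 0) = 0 := fun p hp => by
    have : ¬ p.1 < N := by simpa using hp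
    simp [this]
  have hsum : Summable fun p : ℕ × Fin d =>
      if p.1 < N then w d p * min |φ p.1 p.2 - φ' p.1 p.2| 1 else 0 :=
    summable_of_ne_finset_zero hfin
  have h := (summable_w_mul_min φ φ').tsum_le_tsum hle (hsum.add (summable_tailWeight N))
  rw [hsum.tsum_add (summable_tailWeight N), tsum_eq_sum hfin] at h
  have h2 := mul_le_mul_of_nonneg_left h (inv_nonneg.2 (Cd_nonneg (d := d)))
  rw [mul_add, Finset.mul_sum] at h2
  refine h2.trans (add_le_add (Finset.sum_le_sum fun p hp => ?_) le_rfl)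
  have hp' : p.1 < N := by simpa using hp
  rw [if_pos hp', ← mul_assoc]
  exact mul_le_of_le_one_left (by positivity) (inv_Cd_mul_w_le_one p)

lemma continuous_cfgDist_left (φ' : ℕ → Fin d → ℝ) : Continuous fun φ => cfgDist d φ φ' := by
  unfold cfgDist
  refine continuous_const.mul (continuous_tsum (fun p => by fun_prop) summable_w fun p φ => ?_)
  rw [Real.norm_of_nonneg (mul_nonneg (w_pos p).le (by positivity))]
  exact mul_le_of_le_one_right (w_pos p).le (min_le_right _ _)

lemma continuous_of_le_cfgDist {f : (ℕ → Fin d → ℝ) → ℝ}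
    (hf : ∀ φ φ', |f φ - f φ'| ≤ cfgDist d φ φ') : Continuous f := by
  refine continuous_iff_continuousAt.2 fun φ' => ?_
  refine tendsto_iff_norm_sub_tendsto_zero.2 (squeeze_zero (fun φ => norm_nonneg _)
    (fun φ => hf φ φ') ?_)
  have h := (continuous_cfgDist_left φ').tendsto φ'
  rwa [show cfgDist d φ' φ' = 0 by simp [cfgDist]] at h

lemma blDistCfg_nonneg (μ ν : Measure (ℕ → Fin d → ℝ)) : 0 ≤ blDistCfg d μ ν := by
  refine Real.sSup_nonneg ?_
  rintro r ⟨f, -, -, rfl⟩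
  exact abs_nonneg _

end Metric

section ProdGaussian

open ProbabilityTheory

lemma gaussianReal_map_affine (μ b : ℝ) {v : NNReal} (hv : (v : ℝ) = b ^ 2) :
    (gaussianReal 0 1).map (fun x => μ + b * x) = gaussianReal μ v := by
  have h : (fun x : ℝ => μ + b * x) = (fun x => μ + x) ∘ fun x => b * x := rfl
  rw [h, ← Measure.map_map (by fun_prop) (by fun_prop), gaussianReal_map_const_mul,
    gaussianReal_map_const_add]
  congr 1
  · simp
  · ext
    simp [hv]

lemma stdGaussian_map_affine {ι κ : Type*} [Fintype ι] [Fintype κ] (μ : ι → κ → ℝ) (b : ℝ)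
    {v : NNReal} (hv : (v : ℝ) = b ^ 2) :
    (stdGaussian (EuclideanSpace ℝ (ι × κ))).map (fun g i j => μ i j + b * g (i, j)) =
      Measure.pi fun i => Measure.pi fun j => gaussianReal (μ i j) v := by
  have h1 : (Measure.pi fun _ : ι × κ => gaussianReal 0 1).map
      (fun x p => μ p.1 p.2 + b * x p) = Measure.pi fun p : ι × κ => gaussianReal (μ p.1 p.2) v := by
    have : ∀ p : ι × κ, IsProbabilityMeasure
        ((gaussianReal 0 1).map fun x => μ p.1 p.2 + b * x) := fun p =>
      Measure.isProbabilityMeasure_map (by fun_prop)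
    rw [Measure.pi_map_pi (f := fun (p : ι × κ) x => μ p.1 p.2 + b * x)
      fun p => by fun_prop]
    simp only [gaussianReal_map_affine _ b hv]
  have h2 := Measure.infinitePi_map_curry (X := ℝ) fun (i : ι) (j : κ) => gaussianReal (μ i j) v
  simp only [Measure.infinitePi_eq_pi] at h2
  rw [← h2, ← h1, ← map_pi_eq_stdGaussian, Measure.map_map (by fun_prop) (by fun_prop),
    Measure.map_map (by fun_prop) (by fun_prop)]
  rfl

variable {d : ℕ}

/-- The Gaussian configuration on the first `n` sites, extended by zero. -/
noncomputable def gaussCfg (n : ℕ) (μ : ℕ → Fin d → ℝ) (b : ℝ)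
    (g : EuclideanSpace ℝ (Fin n × Fin d)) : ℕ → Fin d → ℝ :=
  fun i j => if hi : i < n then μ i j + b * g (⟨i, hi⟩, j) else 0

@[fun_prop]
lemma measurable_gaussCfg (n : ℕ) (μ : ℕ → Fin d → ℝ) (b : ℝ) : Measurable (gaussCfg n μ b) := by
  refine measurable_pi_iff.2 fun i => measurable_pi_iff.2 fun j => ?_
  by_cases hi : i < n
  · simp only [gaussCfg, hi, dite_true]
    fun_prop
  · simp [gaussCfg, hi]

lemma integrable_of_abs_le_one {α : Type*} [MeasurableSpace α] {P : Measure α} [IsFiniteMeasure P]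
    {f : α → ℝ} (hf : Measurable f) (h1 : ∀ x, |f x| ≤ 1) : Integrable f P :=
  Integrable.of_bound hf.aestronglyMeasurable 1 (ae_of_all _ h1)

lemma abs_integral_gaussCfg_sub_le {μ : ℕ → Fin d → ℝ} {v : NNReal}
    {ν : Measure (ℕ → Fin d → ℝ)} (hν : IsProdGaussian d μ v ν) {b : ℝ} (hv : (v : ℝ) = b ^ 2)
    (n : ℕ) {f : (ℕ → Fin d → ℝ) → ℝ} (hf1 : ∀ φ, |f φ| ≤ 1)
    (hf : ∀ φ φ', |f φ - f φ'| ≤ cfgDist d φ φ') :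
    |∫ g, f (gaussCfg n μ b g) ∂(stdGaussian (EuclideanSpace ℝ (Fin n × Fin d))) -
      ∫ φ, f φ ∂ν| ≤ tailWeight d n := by
  have := hν.1
  have hfm := (continuous_of_le_cfgDist hf).measurable
  let ext : (Fin n → Fin d → ℝ) → ℕ → Fin d → ℝ := fun ψ i j =>
    if hi : i < n then ψ ⟨i, hi⟩ j else 0
  have hext : Measurable ext := by
    refine measurable_pi_iff.2 fun i => measurable_pi_iff.2 fun j => ?_
    by_cases hi : i < n
    · simp only [ext, hi, dite_true]
      fun_prop
    · simp [ext, hi]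
  have hr : Measurable fun (φ : ℕ → Fin d → ℝ) (i : Fin n) => φ (i : ℕ) :=
    measurable_pi_iff.2 fun i => measurable_pi_apply _
  have h1 : ∫ g, f (gaussCfg n μ b g) ∂(stdGaussian (EuclideanSpace ℝ (Fin n × Fin d))) =
      ∫ φ, f (ext fun i : Fin n => φ (i : ℕ)) ∂ν := by
    have h2 := stdGaussian_map_affine (fun (i : Fin n) j => μ i j) b hv
    rw [← hν.2 n] at h2
    have h3 := integral_map (μ := ν) hr.aemeasurable (hfm.comp hext).aestronglyMeasurable
    rw [← h2, integral_map (by fun_prop) (hfm.comp hext).aestronglyMeasurable] at h3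
    exact h3
  have hres : Measurable fun φ : ℕ → Fin d → ℝ => ext fun i : Fin n => φ (i : ℕ) := hext.comp hr
  have hi : Integrable (fun φ => f (ext fun i : Fin n => φ (i : ℕ))) ν :=
    integrable_of_abs_le_one (hfm.comp hres) fun φ => hf1 _
  rw [h1, ← integral_sub hi (integrable_of_abs_le_one hfm hf1), ← Real.norm_eq_abs]
  refine (norm_integral_le_of_norm_le_const (μ := ν) (C := tailWeight d n)
    (ae_of_all _ fun φ => ?_)).trans_eq (by rw [probReal_univ, mul_one])
  refine (hf _ _).trans ((cfgDist_le n _ _).trans (le_of_eq ?_))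
  rw [Finset.sum_eq_zero, zero_add]
  intro p hp
  have hp' : p.1 < n := by simpa using hp
  simp [ext, hp']

end ProdGaussian

section Comparison

open ProbabilityTheory

variable {d n M : ℕ} {h : ℕ → Fin d → ℝ} {β : ℝ}
  (I : WithLp 2 (MagSpace d × EuclideanSpace ℝ (Fin M)) ≃ₗᵢ[ℝ] EuclideanSpace ℝ (Fin n × Fin d))

/-- The configuration built from a low-dimensional part and a direction. -/
noncomputable def splitCfg (p : MagSpace d × EuclideanSpace ℝ (Fin M)) : ℕ → Fin d → ℝ :=
  extendCfg d n (contr p.1 • I (WithLp.toLp 2 p))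

lemma measurable_splitCfg : Measurable (splitCfg I) :=
  measurable_extendCfg.comp (measurable_contr_smul_splitting I)

/-- The normalized component of a vector in the complement of the low-dimensional part. -/
noncomputable def splitDir (g : EuclideanSpace ℝ (Fin n × Fin d)) : EuclideanSpace ℝ (Fin M) :=
  ‖(I.symm g).snd‖⁻¹ • (I.symm g).snd

lemma measurable_splitDir : Measurable (splitDir I) := by
  have hsnd : Measurable fun g => (I.symm g).snd :=
    ((WithLp.continuous_snd ..).comp I.symm.continuous).measurable
  unfold splitDir
  fun_prop

lemma stdGaussian_map_splitDir :
    (stdGaussian (EuclideanSpace ℝ (Fin n × Fin d))).map (splitDir I) =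
      dirLaw (EuclideanSpace ℝ (Fin M)) := by
  have hsnd : Measurable fun g => (I.symm g).snd :=
    ((WithLp.continuous_snd ..).comp I.symm.continuous).measurable
  rw [dirLaw, ← stdGaussian_map_snd_symm I, Measure.map_map (by fun_prop) hsnd]
  rfl

lemma integral_gibbs_eq (hd : 1 ≤ d) (hn : 3 ≤ n) (hs : ∀ j, 0 < sampleStd d h n j)
    (hM : M + 2 * d = n * d) (hI : ∀ a p, I (WithLp.toLp 2 (a, 0)) p =
      (a.fst p.2 + a.snd p.2 * eta d h n p.1 p.2) / Real.sqrt n)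
    [IsProbabilityMeasure (magLaw d n β h)] {f : (ℕ → Fin d → ℝ) → ℝ} (hf : Measurable f)
    (hf1 : ∀ φ, |f φ| ≤ 1) :
    ∫ φ, f φ ∂(gibbs d n β h) = ∫ a, ∫ g, f (splitCfg I (a, splitDir I g))
      ∂(stdGaussian (EuclideanSpace ℝ (Fin n × Fin d))) ∂(magLaw d n β h) := by
  have hΘ := hf.comp (measurable_splitCfg I)
  have hgibbs : gibbs d n β h = ((magLaw d n β h).prod
      (dirLaw (EuclideanSpace ℝ (Fin M)))).map (splitCfg I) := gibbs_eq hd hn β hs hM I hI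
  have hfint : Integrable (f ∘ splitCfg I)
      ((magLaw d n β h).prod (dirLaw (EuclideanSpace ℝ (Fin M)))) :=
    integrable_of_abs_le_one hΘ fun p => hf1 _
  rw [hgibbs, integral_map (measurable_splitCfg I).aemeasurable hf.aestronglyMeasurable]
  refine (integral_prod _ hfint).trans (integral_congr_ae (ae_of_all _ fun a => ?_))
  have hΘa : Measurable fun w => (f ∘ splitCfg I) (a, w) := hΘ.comp measurable_prodMk_left
  simp only
  rw [← stdGaussian_map_splitDir I,
    integral_map (measurable_splitDir I).aemeasurable hΘa.aestronglyMeasurable]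
  rfl

lemma norm_symm_single_fst_le (hn : 0 < n) (hI : ∀ a p, I (WithLp.toLp 2 (a, 0)) p =
      (a.fst p.2 + a.snd p.2 * eta d h n p.1 p.2) / Real.sqrt n) (p : Fin n × Fin d) :
    ‖(I.symm (EuclideanSpace.single p 1)).fst‖ ≤ (1 + |eta d h n p.1 p.2|) / Real.sqrt n := by
  set x := (I.symm (EuclideanSpace.single p 1)).fst
  have h1 : ‖x‖ ^ 2 = (x.fst p.2 + x.snd p.2 * eta d h n p.1 p.2) / Real.sqrt n := by
    rw [← hI, ← real_inner_self_eq_norm_sq]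
    have h2 := I.inner_map_map (WithLp.toLp 2 (x, 0)) (I.symm (EuclideanSpace.single p 1))
    rw [I.apply_symm_apply, EuclideanSpace.inner_single_right] at h2
    have h3 : inner ℝ (WithLp.toLp 2 (x, 0)) (I.symm (EuclideanSpace.single p 1)) =
        inner ℝ x x := by
      rw [WithLp.prod_inner_apply]
      simp only [inner_zero_left, add_zero]
      rfl
    rw [← h3, ← h2]
    simp
  have h3 : |x.fst p.2| ≤ ‖x‖ := (PiLp.norm_apply_le x.fst p.2).trans (WithLp.norm_fst_le ..)
  have h4 : |x.snd p.2| ≤ ‖x‖ := (PiLp.norm_apply_le x.snd p.2).trans (WithLp.norm_snd_le ..)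
  have h5 : x.fst p.2 + x.snd p.2 * eta d h n p.1 p.2 ≤ ‖x‖ * (1 + |eta d h n p.1 p.2|) := by
    have := mul_le_mul_of_nonneg_right h4 (abs_nonneg (eta d h n p.1 p.2))
    rw [← abs_mul] at this
    linarith [le_abs_self (x.fst p.2), le_abs_self (x.snd p.2 * eta d h n p.1 p.2)]
  rcases (norm_nonneg x).eq_or_lt with h0 | h0
  · rw [← h0]
    positivity
  · refine le_of_mul_le_mul_left ?_ h0
    rw [← sq, h1, mul_div_assoc']
    gcongr

/-- The mean of the limiting product state with direction `m`. -/
noncomputable def limitMean (β : ℝ) (h : ℕ → Fin d → ℝ) (s m : EuclideanSpace ℝ (Fin d)) :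
    ℕ → Fin d → ℝ :=
  fun i j => Real.sqrt (1 - d / β - ‖s‖ ^ 2) * (‖m‖⁻¹ * m j) + h i j

lemma integral_min_abs_splitCfg_sub_le (hd : 1 ≤ d) (hn : 1 ≤ n) (hM : M + 2 * d = n * d)
    (hβ : (d : ℝ) / β ≤ 1) (hI : ∀ a p, I (WithLp.toLp 2 (a, 0)) p =
      (a.fst p.2 + a.snd p.2 * eta d h n p.1 p.2) / Real.sqrt n)
    (s m : EuclideanSpace ℝ (Fin d)) (a : MagSpace d) {i : ℕ} (hi : i < n) (j : Fin d) :
    ∫ g, min |splitCfg I (a, splitDir I g) i j - gaussCfg n (limitMean β h s m)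
        (Real.sqrt (d / β) / Real.sqrt d) g i j| 1 ∂(stdGaussian (EuclideanSpace ℝ (Fin n × Fin d))) ≤
      (3 + |eta d h n i j|) * magDev d β s m a + |s j * eta d h n i j - h i j| +
        (2 + 10 * (d * Var[fun x : ℝ => x ^ 2; gaussianReal 0 1] + 4 * d ^ 2) +
          (1 + |eta d h n i j|) ^ 2) / Real.sqrt n := by
  have hl : 0 < Real.sqrt n := Real.sqrt_pos.2 (by exact_mod_cast hn)
  set p : Fin n × Fin d := (⟨i, hi⟩, j)
  set η := eta d h n i j
  set u : EuclideanSpace ℝ (Fin n × Fin d) := EuclideanSpace.single p 1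
  set X := contr a • a.fst - Real.sqrt (1 - d / β - ‖s‖ ^ 2) • ‖m‖⁻¹ • m with hX
  set Y := contr a • a.snd - s with hY
  set e₀ := X j + Y j * η + (s j * η - h i j) with he0
  have hX' : |X j| ≤ ‖X‖ := PiLp.norm_apply_le X j
  have hY' : |Y j| ≤ ‖Y‖ := PiLp.norm_apply_le Y j
  have hD : magDev d β s m a = ‖X‖ + ‖Y‖ + |contr a - Real.sqrt (d / β)| := rfl
  have hδ : |contr a - Real.sqrt (d / β)| ≤ magDev d β s m a := by
    linarith [norm_nonneg X, norm_nonneg Y]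
  have he : |e₀| ≤ (1 + |η|) * magDev d β s m a + |s j * η - h i j| := by
    have h1 := abs_add_le (X j + Y j * η) (s j * η - h i j)
    have h2 := abs_add_le (X j) (Y j * η)
    have h3 : |Y j * η| ≤ magDev d β s m a * |η| := by
      rw [abs_mul]
      refine mul_le_mul_of_nonneg_right ?_ (abs_nonneg _)
      linarith [norm_nonneg X, abs_nonneg (contr a - Real.sqrt (d / β))]
    linarith [norm_nonneg Y, abs_nonneg (contr a - Real.sqrt (d / β))]
  have hin : ∀ x : EuclideanSpace ℝ (Fin n × Fin d), inner ℝ u x = x p := fun x => by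
    simp [u, EuclideanSpace.inner_single_left]
  have hkey := integral_min_abs_coupling_le hd hn hM I (u := u) (by simp [u])
    (norm_symm_single_fst_le I hn hI p) (Real.sqrt_nonneg (d / β)) (Real.sqrt_le_one.2 hβ) hδ he
  refine le_of_eq_of_le (integral_congr_ae (ae_of_all _ fun g => ?_)) (hkey.trans (le_of_eq ?_))
  · simp only [hin]
    congr 2
    have hsplit : I (WithLp.toLp 2 (a, ‖(I.symm g).snd‖⁻¹ • (I.symm g).snd)) =
        I (WithLp.toLp 2 (a, 0)) +
          ‖(I.symm g).snd‖⁻¹ • I (WithLp.toLp 2 (0, (I.symm g).snd)) := by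
      rw [← map_smul, ← map_add, ← WithLp.toLp_smul, ← WithLp.toLp_add]
      simp
    have hp1 : ((p.1 : Fin n) : ℕ) = i := rfl
    have hp2 : p.2 = j := rfl
    simp only [splitCfg, splitDir, gaussCfg, extendCfg, hi, dite_true, hsplit, PiLp.smul_apply,
      PiLp.add_apply, hI, smul_eq_mul, limitMean, he0, hX, hY, PiLp.sub_apply]
    change Real.sqrt n * (contr a * ((a.fst j + a.snd j * η) / Real.sqrt n +
      ‖(I.symm g).snd‖⁻¹ * I (WithLp.toLp 2 (0, (I.symm g).snd)) p)) - _ = _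
    rw [div_div_eq_mul_div, div_eq_mul_inv (contr a * Real.sqrt n)]
    field_simp
    ring
  · simp only [p]
    ring

lemma integral_affine {α : Type*} [MeasurableSpace α] {P : Measure α} [IsProbabilityMeasure P]
    {F : α → ℝ} (hF : Integrable F P) (x y z : ℝ) :
    ∫ a, (x * F a + y + z) ∂P = x * ∫ a, F a ∂P + y + z := by
  simp_rw [add_assoc]
  rw [integral_add (hF.const_mul x) (integrable_const _), integral_const_mul]
  simp

lemma abs_integral_gibbs_sub_le (hd : 1 ≤ d) (hn : 3 ≤ n) (hs : ∀ j, 0 < sampleStd d h n j)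
    (hβ : (d : ℝ) / β ≤ 1) [IsProbabilityMeasure (magLaw d n β h)]
    (s m : EuclideanSpace ℝ (Fin d)) {v : NNReal} {ν : Measure (ℕ → Fin d → ℝ)}
    (hν : IsProdGaussian d (limitMean β h s m) v ν)
    (hv : (v : ℝ) = (Real.sqrt (d / β) / Real.sqrt d) ^ 2) {N : ℕ} (hN : N ≤ n)
    {f : (ℕ → Fin d → ℝ) → ℝ} (hf1 : ∀ φ, |f φ| ≤ 1)
    (hf : ∀ φ φ', |f φ - f φ'| ≤ cfgDist d φ φ') :
    |∫ φ, f φ ∂(gibbs d n β h) - ∫ φ, f φ ∂ν| ≤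
      ∑ p ∈ Finset.range N ×ˢ Finset.univ, ((3 + |eta d h n p.1 p.2|) *
        ∫ a, magDev d β s m a ∂(magLaw d n β h) + |s p.2 * eta d h n p.1 p.2 - h p.1 p.2| +
        (2 + 10 * (d * Var[fun x : ℝ => x ^ 2; gaussianReal 0 1] + 4 * d ^ 2) +
          (1 + |eta d h n p.1 p.2|) ^ 2) / Real.sqrt n) + tailWeight d N + tailWeight d n := by
  have hn0 : 0 < n := by omega
  obtain ⟨M, hM, I, hI⟩ : ∃ M, M + 2 * d = n * d ∧
      ∃ I : WithLp 2 (MagSpace d × EuclideanSpace ℝ (Fin M)) ≃ₗᵢ[ℝ]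
        EuclideanSpace ℝ (Fin n × Fin d), ∀ a p, I (WithLp.toLp 2 (a, 0)) p =
          (a.fst p.2 + a.snd p.2 * eta d h n p.1 p.2) / Real.sqrt n := by
    obtain ⟨I, hI⟩ := exists_isometric_splitting
      (fieldEmbedding (eta d h n) hn0 (sum_eta hn0) fun j => sum_eta_sq hn0 (hs j))
    refine ⟨_, ?_, I, fun a p => by rw [hI, fieldEmbedding_apply]⟩
    rw [finrank_euclideanSpace, finrank_magSpace, Fintype.card_prod, Fintype.card_fin,
      Fintype.card_fin]
    exact Nat.sub_add_cancel (Nat.mul_le_mul_right d (by omega))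
  have hfm := (continuous_of_le_cfgDist hf).measurable
  set b := Real.sqrt (d / β) / Real.sqrt d
  set μ := limitMean β h s m
  have hmag : Integrable (magDev d β s m) (magLaw d n β h) :=
    Integrable.of_bound (continuous_magDev m).aestronglyMeasurable _ (ae_of_all _ fun a => by
      rw [Real.norm_of_nonneg (magDev_nonneg m a)]
      exact magDev_le m a)
  have hmeas2 : Measurable fun p : MagSpace d × EuclideanSpace ℝ (Fin n × Fin d) =>
      splitCfg I (p.1, splitDir I p.2) :=
    (measurable_splitCfg I).comp
      (measurable_fst.prodMk ((measurable_splitDir I).comp measurable_snd))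
  have hjoint : Integrable (fun p : MagSpace d × EuclideanSpace ℝ (Fin n × Fin d) =>
      f (splitCfg I (p.1, splitDir I p.2)))
      ((magLaw d n β h).prod (stdGaussian (EuclideanSpace ℝ (Fin n × Fin d)))) :=
    integrable_of_abs_le_one (hfm.comp hmeas2) fun p => hf1 _
  have hga : Integrable (fun g => f (gaussCfg n μ b g)) (stdGaussian (EuclideanSpace ℝ (Fin n × Fin d))) :=
    integrable_of_abs_le_one (hfm.comp (measurable_gaussCfg n μ b)) fun g => hf1 _
  have hmeas : ∀ a, Measurable fun g => splitCfg I (a, splitDir I g) := fun a =>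
    (measurable_splitCfg I).comp (measurable_const.prodMk (measurable_splitDir I))
  let B : MagSpace d → ℝ := fun a => ∑ p ∈ Finset.range N ×ˢ Finset.univ,
    ((3 + |eta d h n p.1 p.2|) * magDev d β s m a +
      |s p.2 * eta d h n p.1 p.2 - h p.1 p.2| +
        (2 + 10 * (d * Var[fun x : ℝ => x ^ 2; gaussianReal 0 1] + 4 * d ^ 2) +
          (1 + |eta d h n p.1 p.2|) ^ 2) / Real.sqrt n) + tailWeight d N
  have hfix : ∀ a, |∫ g, f (splitCfg I (a, splitDir I g)) ∂(stdGaussian (EuclideanSpace ℝ (Fin n × Fin d))) -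
      ∫ g, f (gaussCfg n μ b g) ∂(stdGaussian (EuclideanSpace ℝ (Fin n × Fin d)))| ≤ B a := fun a => by
    have hi : Integrable (fun g => f (splitCfg I (a, splitDir I g))) (stdGaussian (EuclideanSpace ℝ (Fin n × Fin d))) :=
      integrable_of_abs_le_one (hfm.comp (hmeas a)) fun g => hf1 _
    have hmin : ∀ p : ℕ × Fin d, Integrable (fun g => min |splitCfg I (a, splitDir I g) p.1 p.2 -
        gaussCfg n μ b g p.1 p.2| 1) (stdGaussian (EuclideanSpace ℝ (Fin n × Fin d))) := fun p => by
      have h1 : Measurable fun g => splitCfg I (a, splitDir I g) p.1 p.2 :=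
        measurable_pi_iff.1 (measurable_pi_iff.1 (hmeas a) p.1) p.2
      have h2 : Measurable fun g => gaussCfg n μ b g p.1 p.2 :=
        measurable_pi_iff.1 (measurable_pi_iff.1 (measurable_gaussCfg n μ b) p.1) p.2
      refine integrable_of_abs_le_one (by fun_prop) fun g => ?_
      rw [abs_of_nonneg (by positivity)]
      exact min_le_right _ _
    rw [← integral_sub hi hga]
    refine abs_integral_le_integral_abs.trans ((integral_mono (hi.sub hga).abs
      ((integrable_finsetSum _ fun p _ => hmin p).add (integrable_const (tailWeight d N)))
      fun g => (hf _ _).trans (cfgDist_le N _ _)).trans ?_)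
    simp only [Pi.add_apply]
    rw [integral_add (integrable_finsetSum _ fun p _ => hmin p) (integrable_const _),
      integral_finsetSum _ fun p _ => hmin p, integral_const, probReal_univ, one_smul]
    refine add_le_add_left (Finset.sum_le_sum fun p hp => ?_) _
    exact integral_min_abs_splitCfg_sub_le I hd (by omega) hM hβ hI s m a
      ((Finset.mem_range.1 (Finset.mem_product.1 hp).1).trans_le hN) p.2
  have hterm : ∀ p : ℕ × Fin d, Integrable (fun a => (3 + |eta d h n p.1 p.2|) * magDev d β s m a +
      |s p.2 * eta d h n p.1 p.2 - h p.1 p.2| +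
        (2 + 10 * (d * Var[fun x : ℝ => x ^ 2; gaussianReal 0 1] + 4 * d ^ 2) +
          (1 + |eta d h n p.1 p.2|) ^ 2) / Real.sqrt n) (magLaw d n β h) := fun p =>
    ((hmag.const_mul _).add (integrable_const _)).add (integrable_const _)
  have hsum := integrable_finsetSum (Finset.range N ×ˢ Finset.univ) fun p _ => hterm p
  have hB : Integrable B (magLaw d n β h) := hsum.add (integrable_const _)
  have hBint : ∫ a, B a ∂(magLaw d n β h) =
      ∑ p ∈ Finset.range N ×ˢ Finset.univ, ((3 + |eta d h n p.1 p.2|) *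
        ∫ a, magDev d β s m a ∂(magLaw d n β h) + |s p.2 * eta d h n p.1 p.2 - h p.1 p.2| +
        (2 + 10 * (d * Var[fun x : ℝ => x ^ 2; gaussianReal 0 1] + 4 * d ^ 2) +
          (1 + |eta d h n p.1 p.2|) ^ 2) / Real.sqrt n) + tailWeight d N := by
    simp only [B]
    rw [integral_add hsum (integrable_const _), integral_finsetSum _ fun p _ => hterm p,
      integral_const, probReal_univ, one_smul]
    congr 1
    exact Finset.sum_congr rfl fun p _ => integral_affine hmag _ _ _
  rw [← hBint]
  have h1 : |∫ φ, f φ ∂(gibbs d n β h) - ∫ g, f (gaussCfg n μ b g) ∂(stdGaussian (EuclideanSpace ℝ (Fin n × Fin d)))| ≤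
      ∫ a, B a ∂(magLaw d n β h) := by
    rw [integral_gibbs_eq I hd hn hs hM hI hfm hf1]
    have h2 : ∫ g, f (gaussCfg n μ b g) ∂(stdGaussian (EuclideanSpace ℝ (Fin n × Fin d))) =
        ∫ _a, ∫ g, f (gaussCfg n μ b g) ∂(stdGaussian (EuclideanSpace ℝ (Fin n × Fin d))) ∂(magLaw d n β h) := by simp
    rw [h2, ← integral_sub hjoint.integral_prod_left (integrable_const _)]
    exact abs_integral_le_integral_abs.trans (integral_mono
      (hjoint.integral_prod_left.sub (integrable_const _)).abs hB hfix)
  have h3 := abs_integral_gaussCfg_sub_le hν hv n hf1 hf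
  exact (abs_sub_le _ _ _).trans (add_le_add h1 h3)

end Comparison

section Limit

open ProbabilityTheory

variable {d : ℕ} {β : ℝ} {h : ℕ → Fin d → ℝ} {s : Fin d → ℝ}

lemma norm_sq_toLp_eq_ip (x : Fin d → ℝ) : ‖(WithLp.toLp 2 x : EuclideanSpace ℝ (Fin d))‖ ^ 2 =
    ip x x := by
  rw [← real_inner_self_eq_norm_sq, euclidean_inner_eq_ip]

lemma norm_toLp_eq_sqrt_ip (x : Fin d → ℝ) :
    ‖(WithLp.toLp 2 x : EuclideanSpace ℝ (Fin d))‖ = Real.sqrt (ip x x) := by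
  rw [← norm_sq_toLp_eq_ip, Real.sqrt_sq (norm_nonneg _)]

lemma tendsto_eta (hm : Tendsto (sampleMean d h) atTop (𝓝 0))
    (hs : Tendsto (sampleStd d h) atTop (𝓝 s)) (hspos : ∀ j, 0 < s j) (i : ℕ) (j : Fin d) :
    Tendsto (fun n => eta d h n i j) atTop (𝓝 (h i j / s j)) := by
  have h1 := ((tendsto_pi_nhds.1 hm j).const_sub (h i j)).div (tendsto_pi_nhds.1 hs j)
    (hspos j).ne'
  rw [Pi.zero_apply, sub_zero] at h1
  exact h1

lemma tendsto_error_term (hm : Tendsto (sampleMean d h) atTop (𝓝 0))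
    (hs : Tendsto (sampleStd d h) atTop (𝓝 s)) (hspos : ∀ j, 0 < s j) {D : ℕ → ℝ}
    (hD : Tendsto D atTop (𝓝 0)) (C : ℝ) (p : ℕ × Fin d) :
    Tendsto (fun n : ℕ => (3 + |eta d h n p.1 p.2|) * D n +
      |s p.2 * eta d h n p.1 p.2 - h p.1 p.2| + (C + (1 + |eta d h n p.1 p.2|) ^ 2) / Real.sqrt n)
      atTop (𝓝 0) := by
  have hη := tendsto_eta hm hs hspos p.1 p.2
  have h1 := (hη.abs.const_add 3).mul hD
  have h2 := ((hη.const_mul (s p.2)).sub_const (h p.1 p.2)).abs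
  have h3 := (((hη.abs.const_add 1).pow 2).const_add C).div_atTop
    (Real.tendsto_sqrt_atTop.comp tendsto_natCast_atTop_atTop)
  have h4 := (h1.add h2).add h3
  rw [mul_div_cancel₀ _ (hspos p.2).ne'] at h4
  simpa using h4

lemma coe_pureVar_eq (hd : 1 ≤ d) (hβ : 0 < β) (hr : 0 ≤ 1 - d / β - ip s s) {m : Fin d → ℝ}
    (hm : ip m m ≠ 0) :
    (pureVar d (fun j => Real.sqrt (1 - d / β - ip s s) * (m j / Real.sqrt (ip m m))) s : ℝ) =
      (Real.sqrt (d / β) / Real.sqrt d) ^ 2 := by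
  have hd' : (0 : ℝ) < d := by exact_mod_cast hd
  have hm0 : 0 ≤ ip m m := Finset.sum_nonneg fun j _ => mul_self_nonneg _
  have hx : ip (fun j => Real.sqrt (1 - d / β - ip s s) * (m j / Real.sqrt (ip m m)))
      (fun j => Real.sqrt (1 - d / β - ip s s) * (m j / Real.sqrt (ip m m))) =
      1 - d / β - ip s s := by
    have : ∀ j, Real.sqrt (1 - d / β - ip s s) * (m j / Real.sqrt (ip m m)) *
        (Real.sqrt (1 - d / β - ip s s) * (m j / Real.sqrt (ip m m))) =
        (1 - d / β - ip s s) / ip m m * (m j * m j) := fun j => by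
      rw [mul_mul_mul_comm, Real.mul_self_sqrt hr, div_mul_div_comm, Real.mul_self_sqrt hm0]
      ring
    rw [ip]
    simp_rw [this]
    rw [← Finset.mul_sum]
    exact div_mul_cancel₀ _ hm
  rw [pureVar, hx, Real.coe_toNNReal, div_pow, Real.sq_sqrt (by positivity),
    Real.sq_sqrt hd'.le]
  · ring
  · rw [show 1 - (1 - d / β - ip s s) - ip s s = d / β by ring]
    positivity

lemma pureMean_eq_limitMean (hspos : ∀ j, 0 < s j) (m : Fin d → ℝ) :
    pureMean d h 0 s (fun j => Real.sqrt (1 - d / β - ip s s) * (m j / Real.sqrt (ip m m))) s =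
      limitMean β h (WithLp.toLp 2 s) (WithLp.toLp 2 m) := by
  ext i j
  rw [pureMean, limitMean, norm_sq_toLp_eq_ip, norm_toLp_eq_sqrt_ip, Pi.zero_apply, sub_zero,
    mul_div_cancel_left₀ _ (hspos j).ne', div_eq_inv_mul (m j)]

end Limit

/-- Convergence of the Gibbs states to the pure states in the direction of the sample
mean, in the ferromagnetic regime with unbounded sums of external fields: n‖mₙ‖ → ∞. -/
theorem stmt17 (d : ℕ) (hd : 1 ≤ d) (β : ℝ) (hβ : 0 < β) (h : ℕ → Fin d → ℝ)
    (s : Fin d → ℝ)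
    (hm : Tendsto (sampleMean d h) atTop (𝓝 0))
    (hs : Tendsto (sampleStd d h) atTop (𝓝 s))
    (hspos : ∀ j, 0 < s j)
    (hsum : Summable (fun p : ℕ × Fin d => |h p.1 p.2| * w d p))
    (hs1 : ip s s < 1) (hferro : (d : ℝ) / (1 - ip s s) < β)
    (hunbdd : Tendsto (fun n : ℕ =>
        (n : ℝ) * Real.sqrt (ip (sampleMean d h n) (sampleMean d h n)))
      atTop atTop)
    (ν : ℕ → Measure (ℕ → Fin d → ℝ))
    (hν : ∀ n : ℕ,
      IsProdGaussian d
        (pureMean d h 0 s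
          (fun j => Real.sqrt (1 - (d : ℝ) / β - ip s s) *
            (sampleMean d h n j / Real.sqrt (ip (sampleMean d h n) (sampleMean d h n))))
          s)
        (pureVar d
          (fun j => Real.sqrt (1 - (d : ℝ) / β - ip s s) *
            (sampleMean d h n j / Real.sqrt (ip (sampleMean d h n) (sampleMean d h n))))
          s)
        (ν n)) :
    Tendsto (fun n : ℕ => blDistCfg d (gibbs d n β h) (ν n)) atTop (𝓝 0) := by
  have hd0 : 0 < d := hd
  have := Fin.pos_iff_nonempty.1 hd0
  have hr : 0 < 1 - (d : ℝ) / β - ip s s := by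
    rw [div_lt_iff₀ (by linarith)] at hferro
    have : (d : ℝ) / β < 1 - ip s s := by
      rw [div_lt_iff₀ hβ]
      linarith
    linarith
  have hss : 0 ≤ ip s s := Finset.sum_nonneg fun j _ => mul_self_nonneg _
  have hr' : 0 < 1 - (d : ℝ) / β - ‖(WithLp.toLp 2 s : EuclideanSpace ℝ (Fin d))‖ ^ 2 := by
    rwa [norm_sq_toLp_eq_ip]
  have hE : Module.finrank ℝ (EuclideanSpace ℝ (Fin d)) = d := by simp
  have hprob : ∀ n, 3 ≤ n → IsProbabilityMeasure (magLaw d n β h) := fun n hn =>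
    have h1 := gibbsWeight_univ_ne_zero_and_ne_top hE hd0 hβ hr' hn
      (WithLp.toLp 2 (sampleMean d h n)) (WithLp.toLp 2 (sampleStd d h n))
    isProbabilityMeasure_nrm h1.1 h1.2
  have hcont : Continuous (WithLp.toLp 2 : (Fin d → ℝ) → EuclideanSpace ℝ (Fin d)) :=
    PiLp.continuous_toLp 2 _
  have hD : Tendsto (fun n => ∫ a, magDev d β (WithLp.toLp 2 s)
      (WithLp.toLp 2 (sampleMean d h n)) a ∂(magLaw d n β h)) atTop (𝓝 0) := by
    refine tendsto_integral_magDev hE hd0 hβ hr' ?_ ((hcont.tendsto s).comp hs) ?_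
    · have h1 := (hcont.tendsto 0).comp hm
      rwa [WithLp.toLp_zero] at h1
    · simpa only [norm_toLp_eq_sqrt_ip] using hunbdd
  set D := fun n => ∫ a, magDev d β (WithLp.toLp 2 s)
      (WithLp.toLp 2 (sampleMean d h n)) a ∂(magLaw d n β h)
  set C := 2 + 10 * (d * ProbabilityTheory.variance (fun x : ℝ => x ^ 2)
    (ProbabilityTheory.gaussianReal 0 1) + 4 * d ^ 2)
  have hbound : ∀ N : ℕ, ∀ᶠ n in atTop, blDistCfg d (gibbs d n β h) (ν n) ≤
      ∑ p ∈ Finset.range N ×ˢ Finset.univ, ((3 + |eta d h n p.1 p.2|) * D n +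
        |s p.2 * eta d h n p.1 p.2 - h p.1 p.2| +
        (C + (1 + |eta d h n p.1 p.2|) ^ 2) / Real.sqrt n) + tailWeight d N + tailWeight d n := by
    intro N
    have hspos' : ∀ᶠ n in atTop, ∀ j, 0 < sampleStd d h n j := by
      rw [eventually_all]
      exact fun j => (tendsto_pi_nhds.1 hs j).eventually_const_lt (hspos j)
    filter_upwards [eventually_ge_atTop 3, eventually_ge_atTop N, hspos',
      hunbdd.eventually_gt_atTop 0] with n hn hN hsn hmn
    have := hprob n hn
    have hmm : ip (sampleMean d h n) (sampleMean d h n) ≠ 0 := fun h0 => by simp [h0] at hmn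
    have hνn := hν n
    rw [pureMean_eq_limitMean hspos] at hνn
    have hle : ∀ r ∈ {r : ℝ | ∃ f : (ℕ → Fin d → ℝ) → ℝ, (∀ φ, |f φ| ≤ 1) ∧
        (∀ φ φ', |f φ - f φ'| ≤ cfgDist d φ φ') ∧
        r = |∫ φ, f φ ∂(gibbs d n β h) - ∫ φ, f φ ∂(ν n)|}, r ≤
        ∑ p ∈ Finset.range N ×ˢ Finset.univ, ((3 + |eta d h n p.1 p.2|) * D n +
          |s p.2 * eta d h n p.1 p.2 - h p.1 p.2| +
          (C + (1 + |eta d h n p.1 p.2|) ^ 2) / Real.sqrt n) + tailWeight d N +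
          tailWeight d n := by
      rintro r ⟨f, hf1, hf, rfl⟩
      exact abs_integral_gibbs_sub_le hd hn hsn (by linarith) _ _ hνn
        (coe_pureVar_eq hd hβ hr.le hmm) hN hf1 hf
    refine csSup_le ⟨_, fun _ => 0, by simp, fun φ φ' => ?_, rfl⟩ hle
    rw [sub_self, abs_zero]
    exact mul_nonneg (inv_nonneg.2 Cd_nonneg) (tsum_nonneg fun p =>
      mul_nonneg (w_pos p).le (by positivity))
  refine Metric.tendsto_nhds.2 fun ε hε => ?_
  obtain ⟨N, hN⟩ := ((tendsto_tailWeight (d := d)).eventually_lt_const (half_pos hε)).exists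
  have hlim := ((tendsto_finsetSum (Finset.range N ×ˢ Finset.univ) fun p _ =>
    tendsto_error_term hm hs hspos hD C p).add_const (tailWeight d N)).add (tendsto_tailWeight (d := d))
  rw [Finset.sum_const_zero, zero_add, add_zero] at hlim
  filter_upwards [hbound N, hlim.eventually_lt_const (hN.trans (half_lt_self hε))] with n h1 h2
  rw [dist_zero_right, Real.norm_of_nonneg (blDistCfg_nonneg _ _)]
  exact h1.trans_lt h2
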